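/- For any k-bounded partition λ and any two k-bounded compositions α and β such that β is a rearrangement of α, the numbers of affine set-valued tableaux coincide: 𝒦^{(k)}_{λα} = 𝒦^{(k)}_{λβ}. -/

import Mathlib

open scoped Classical

namespace AffineKTheory

noncomputable instance : Nonempty YoungDiagram := ⟨⊥⟩

noncomputable instance : Nonempty YoungDiagram := ⟨⊥⟩

/-! ## Cells, hooks, cores, residues -/

/-- Hook length of the cell `(r, c)` in the diagram `γ`. -/
def hookLen (γ : YoungDiagram) (r c : ℕ) : ℕ :=
  (γ.rowLen r - c) + (γ.colLen c - r) - 1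

/-- A `p`-core: a diagram none of whose cells has hook length `p`. -/
def IsCore (p : ℕ) (γ : YoungDiagram) : Prop :=
  ∀ c : ℕ × ℕ, c ∈ γ → hookLen γ c.1 c.2 ≠ p

/-- The `(k+1)`-residue of a cell.  (Rows of the Ferrers shape are indexed so that the cell
directly above `(r, c)` -- in the Ferrers sense of the next, shorter, row -- is `(r+1, c)`.) -/
def residue (k : ℕ) (c : ℕ × ℕ) : ZMod (k + 1) :=
  (c.2 : ZMod (k + 1)) - (c.1 : ZMod (k + 1))

/-- A removable corner of `γ`: a cell of `γ` with no cell above it nor to its right. -/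
def Removable (γ : YoungDiagram) (c : ℕ × ℕ) : Prop :=
  c ∈ γ ∧ (c.1 + 1, c.2) ∉ γ ∧ (c.1, c.2 + 1) ∉ γ

/-- An addable corner of `γ`: a cell outside `γ` whose addition again yields a partition shape. -/
def Addable (γ : YoungDiagram) (c : ℕ × ℕ) : Prop :=
  c ∉ γ ∧ ∀ d : ℕ × ℕ, d ≤ c → d ≠ c → d ∈ γ

/-- A cell is `γ`-blocked if it lies below a cell of `γ`. -/
def Blocked (γ : YoungDiagram) (c : ℕ × ℕ) : Prop :=
  (c.1 + 1, c.2) ∈ γ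

/-- The number of cells of `γ` in row `i` whose hook length is at most `k`:
the `i`-th part of `𝔭(γ)`. -/
noncomputable def pRow (k : ℕ) (γ : YoungDiagram) (i : ℕ) : ℕ :=
  (γ.cells.filter (fun c => c.1 = i ∧ hookLen γ c.1 c.2 ≤ k)).card

/-- The number of cells of `γ` with `k`-bounded hook length, i.e. `|𝔭(γ)|`. -/
noncomputable def pSize (k : ℕ) (γ : YoungDiagram) : ℕ :=
  (γ.cells.filter (fun c => hookLen γ c.1 c.2 ≤ k)).card

/-- A `k`-bounded partition: all parts at most `k`. -/
def IsKBounded (k : ℕ) (lam : YoungDiagram) : Prop :=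
  ∀ i, lam.rowLen i ≤ k

/-- `𝔭(γ)`: the `k`-bounded partition obtained from a `(k+1)`-core `γ` by deleting every cell of
hook length greater than `k` and reading off row lengths. -/
noncomputable def pPart (k : ℕ) (γ : YoungDiagram) : YoungDiagram :=
  Classical.epsilon fun lam => ∀ i, lam.rowLen i = pRow k γ i

/-- `𝔠(λ)`: the unique `(k+1)`-core corresponding to the `k`-bounded partition `λ` under the
bijection `𝔭`. -/
noncomputable def coreOf (k : ℕ) (lam : YoungDiagram) : YoungDiagram :=
  Classical.epsilon fun γ => IsCore (k + 1) γ ∧ ∀ i, pRow k γ i = lam.rowLen i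

/-- The `k`-conjugate `λ^{ω_k} = 𝔭(𝔠(λ)')` of a `k`-bounded partition. -/
noncomputable def kConj (k : ℕ) (lam : YoungDiagram) : YoungDiagram :=
  pPart k ((coreOf k lam).transpose)

/-- A `k`-bounded composition: a list of parts, each between `1` and `k`. -/
def IsKBoundedComp (k : ℕ) (α : List ℕ) : Prop :=
  ∀ a ∈ α, 1 ≤ a ∧ a ≤ k

/-- Dominance order on partitions. -/
def Dominates (mu lam : YoungDiagram) : Prop :=
  mu.card = lam.card ∧
    ∀ n : ℕ, ∑ i ∈ Finset.range n, lam.rowLen i ≤ ∑ i ∈ Finset.range n, mu.rowLen i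


/-! ## Set-valued fillings and affine set-valued tableaux -/

/-- A set-valued filling of the shape `γ`: each cell of `γ` carries a finite nonempty set of
positive integers, empty outside `γ`, with `max X < min Y` when `X` is directly below `Y` and
`max X ≤ min Y` when `X` is directly to the left of `Y`. -/
def IsSVFilling (γ : YoungDiagram) (e : ℕ × ℕ → Finset ℕ) : Prop :=
  (∀ c : ℕ × ℕ, c ∈ γ ↔ (e c).Nonempty) ∧
  (∀ c : ℕ × ℕ, ∀ x ∈ e c, 0 < x) ∧
  (∀ r c : ℕ, ∀ x ∈ e (r, c), ∀ y ∈ e (r + 1, c), x < y) ∧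
  (∀ r c : ℕ, ∀ x ∈ e (r, c), ∀ y ∈ e (r, c + 1), x ≤ y)

/-- The set of cells of `T_{≤ x}`: cells containing a letter `≤ x`. -/
noncomputable def shapeLe (γ : YoungDiagram) (e : ℕ × ℕ → Finset ℕ) (x : ℕ) : Finset (ℕ × ℕ) :=
  γ.cells.filter fun c => ∃ y ∈ e c, y ≤ x

/-- A standard affine set-valued tableau of degree `n` and shape `γ`: a set-valued filling with
letters `1, …, n` such that for each `x`, the shape of `T_{≤x}` is a `(k+1)`-core and the letter
`x` occupies exactly all of its removable corners of one single residue. -/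
def IsStdASVT (k n : ℕ) (γ : YoungDiagram) (e : ℕ × ℕ → Finset ℕ) : Prop :=
  IsSVFilling γ e ∧
  (∀ c : ℕ × ℕ, ∀ y ∈ e c, y ≤ n) ∧
  ∀ x : ℕ, 1 ≤ x → x ≤ n →
    ∃ δ : YoungDiagram, IsCore (k + 1) δ ∧ δ.cells = shapeLe γ e x ∧
      ∃ i : ZMod (k + 1), (∃ c, x ∈ e c) ∧
        ∀ c : ℕ × ℕ, x ∈ e c ↔ Removable δ c ∧ residue k c = i

/-- The alphabet `𝒜_{α,x} = {Σ^{x-1}α + 1, …, Σ^x α}`. -/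
def alphaBlock (α : List ℕ) (x : ℕ) : Finset ℕ :=
  Finset.Ioc ((α.take (x - 1)).sum) ((α.take x).sum)

/-- `c` is the lowest occurrence of the letter `y`. -/
def IsLowestOcc (e : ℕ × ℕ → Finset ℕ) (y : ℕ) (c : ℕ × ℕ) : Prop :=
  y ∈ e c ∧ ∀ d : ℕ × ℕ, y ∈ e d → c.1 ≤ d.1

/-- `a` comes strictly before `b` in the reading order (top to bottom, left to right;
higher rows of the Ferrers shape have larger first coordinate here). -/
def ReadBefore (a b : ℕ × ℕ) : Prop :=
  b.1 < a.1 ∨ (a.1 = b.1 ∧ a.2 < b.2)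

/-- An affine set-valued tableau of weight `α` and shape `γ`: a standard affine set-valued
tableau of degree `|α|` such that for each `x`, the lowest reading word in `𝒜_{α,x}` is
increasing, the letters of `𝒜_{α,x}` occupy exactly `α_x` distinct residues, and they form a
horizontal strip. -/
def IsASVT (k : ℕ) (α : List ℕ) (γ : YoungDiagram) (e : ℕ × ℕ → Finset ℕ) : Prop :=
  IsStdASVT k α.sum γ e ∧
  ∀ x : ℕ, 1 ≤ x → x ≤ α.length →
    (∀ y z : ℕ, y ∈ alphaBlock α x → z ∈ alphaBlock α x → y < z →
      ∀ cy cz : ℕ × ℕ, IsLowestOcc e y cy → IsLowestOcc e z cz → ReadBefore cy cz) ∧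
    (((γ.cells.filter fun c => ∃ y ∈ alphaBlock α x, y ∈ e c).image (residue k)).card
        = α.getD (x - 1) 0) ∧
    (∀ c d : ℕ × ℕ, (∃ y ∈ alphaBlock α x, y ∈ e c) → (∃ y ∈ alphaBlock α x, y ∈ e d) →
      c.2 = d.2 → c = d)

/-- `𝒦^{(k)}_{λα}`: the number of affine set-valued tableaux of shape `𝔠(λ)` and weight `α`. -/
noncomputable def Kcal (k : ℕ) (lam : YoungDiagram) (α : List ℕ) : ℕ :=
  Nat.card {e : ℕ × ℕ → Finset ℕ // IsASVT k α (coreOf k lam) e}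

/-- A `k`-tableau of shape `γ` and weight `α`: a semistandard filling with letters `1,…,ℓ(α)`
(recorded as `0` outside `γ`) in which the letter `i` occupies exactly `α_i` distinct residues. -/
def IsKTab (k : ℕ) (α : List ℕ) (γ : YoungDiagram) (u : ℕ × ℕ → ℕ) : Prop :=
  (∀ c : ℕ × ℕ, c ∈ γ ↔ u c ≠ 0) ∧
  (∀ c : ℕ × ℕ, u c ≤ α.length) ∧
  (∀ r c : ℕ, (r, c) ∈ γ → (r + 1, c) ∈ γ → u (r, c) < u (r + 1, c)) ∧
  (∀ r c : ℕ, (r, c) ∈ γ → (r, c + 1) ∈ γ → u (r, c) ≤ u (r, c + 1)) ∧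
  ∀ i : ℕ, 1 ≤ i → i ≤ α.length →
    ((γ.cells.filter fun c => u c = i).image (residue k)).card = α.getD (i - 1) 0

/-- `K^{(k)}_{λα}`: the number of `k`-tableaux of shape `𝔠(λ)` and weight `α`. -/
noncomputable def Kktab (k : ℕ) (lam : YoungDiagram) (α : List ℕ) : ℕ :=
  Nat.card {u : ℕ × ℕ → ℕ // IsKTab k α (coreOf k lam) u}

/-- A plain set-valued tableau of shape `λ` and weight `α`. -/
def IsSVT (α : List ℕ) (lam : YoungDiagram) (e : ℕ × ℕ → Finset ℕ) : Prop :=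
  IsSVFilling lam e ∧ (∀ c : ℕ × ℕ, ∀ x ∈ e c, x ≤ α.length) ∧
  ∀ i : ℕ, 1 ≤ i → i ≤ α.length →
    (lam.cells.filter fun c => i ∈ e c).card = α.getD (i - 1) 0

/-- `𝒦_{λα}`: the number of set-valued tableaux of shape `λ` and weight `α`. -/
noncomputable def KcalSV (lam : YoungDiagram) (α : List ℕ) : ℕ :=
  Nat.card {e : ℕ × ℕ → Finset ℕ // IsSVT α lam e}

/-! ## A vertex model with commuting row transfer operators -/

section Transfer

variable {R : Type*} [CommRing R]

/-- The site value `b` meets the carried value `c`: either `c` is dropped and `b` is carried on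
(weight `1`), or the smaller of the two is dropped and the larger is carried on (weight `s`),
the latter being forbidden when `b = c`.  The arguments of `f` are the dropped and the carried
value. -/
def vertex (s : R) (c b : ℤ) (f : ℤ → ℤ → R) : R :=
  f c b + s * (if c < b then f c b else if b < c then f b c else 0)

/-- Weighted sum over the ways in which a carrier entering with value `c` crosses the sites. -/
def row (s : R) : List ℤ → ℤ → (List ℤ → ℤ → R) → R
  | [], c, f => f [] c
  | b :: bs, c, f => vertex s c b fun x c' => row s bs c' fun ds => f (x :: ds)

/-- Two carriers crossing the sites one after the other. -/
def doubleRow (s t : R) : List ℤ → ℤ → ℤ → (List ℤ → ℤ → ℤ → R) → R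
  | [], d, c, f => f [] d c
  | b :: bs, d, c, f => vertex s c b fun x c' => vertex t d x fun y d' =>
      doubleRow s t bs d' c' fun es => f (y :: es)

/-- The operator exchanging the two carriers. -/
def exchangeOp (x y : R) (f : ℤ → ℤ → R) (d c : ℤ) : R :=
  x * f d c + y * (if d < c then f d c else if c < d then f c d else 0)

theorem vertex_exchange (s t : R) (g : ℤ → ℤ → ℤ → R) (d c b : ℤ) :
    exchangeOp (1 + t) (s - t)
      (fun d c => vertex s c b fun x c' => vertex t d x fun y d' => g y d' c') d c =
    vertex t c b fun x c' => vertex s d x fun y d' =>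
      exchangeOp (1 + t) (s - t) (g y) d' c' := by
  unfold exchangeOp vertex
  rcases lt_trichotomy d c with h1 | h1 | h1 <;> rcases lt_trichotomy c b with h2 | h2 | h2 <;>
    rcases lt_trichotomy d b with h3 | h3 | h3 <;>
    first
    | (exfalso; omega)
    | (subst_vars; simp [*, lt_asymm]; try ring)

theorem doubleRow_exchange (s t : R) (bs : List ℤ) :
    ∀ (f : List ℤ → ℤ → ℤ → R) (d c : ℤ),
    exchangeOp (1 + t) (s - t) (fun d c => doubleRow s t bs d c f) d c =
      doubleRow t s bs d c (fun es => exchangeOp (1 + t) (s - t) (f es)) := by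
  induction bs with
  | nil => intro f d c; rfl
  | cons b bs ih =>
    intro f d c
    simp only [doubleRow]
    rw [vertex_exchange s t (fun y d' c' => doubleRow s t bs d' c' fun es => f (y :: es))]
    simp only [ih]

theorem row_add (s : R) (bs : List ℤ) : ∀ (c : ℤ) (f g : List ℤ → ℤ → R),
    row s bs c (fun ds c' => f ds c' + g ds c') = row s bs c f + row s bs c g := by
  induction bs with
  | nil => intro c f g; rfl
  | cons b bs ih =>
    intro c f g
    simp only [row, vertex, ih]
    split_ifs <;> ring

theorem row_mul (s : R) (bs : List ℤ) : ∀ (c : ℤ) (a : R) (f : List ℤ → ℤ → R),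
    row s bs c (fun ds c' => a * f ds c') = a * row s bs c f := by
  induction bs with
  | nil => intro c a f; rfl
  | cons b bs ih =>
    intro c a f
    simp only [row, vertex, ih]
    split_ifs <;> ring

theorem row_zero (s : R) (bs : List ℤ) (c : ℤ) :
    row s bs c (fun _ _ => (0 : R)) = 0 := by
  simpa using row_mul s bs c 0 (fun _ _ => (0 : R))

theorem row_sum (s : R) (bs : List ℤ) (c : ℤ) {ι : Type*} (G : Finset ι)
    (f : ι → List ℤ → ℤ → R) :
    row s bs c (fun ds c' => ∑ i ∈ G, f i ds c') = ∑ i ∈ G, row s bs c (f i) := by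
  induction G using Finset.induction_on with
  | empty => simpa using row_zero s bs c
  | insert i G hi ih => simp only [Finset.sum_insert hi, row_add, ih]

theorem row_vertex (s t : R) (bs : List ℤ) (c d x : ℤ) (g : ℤ → ℤ → List ℤ → ℤ → R) :
    row s bs c (fun ds c' => vertex t d x fun y d' => g y d' ds c') =
      vertex t d x fun y d' => row s bs c (g y d') := by
  unfold vertex
  rw [row_add, row_mul]
  split_ifs <;> simp [row_zero]

theorem doubleRow_eq (s t : R) (bs : List ℤ) : ∀ (d c : ℤ) (f : List ℤ → ℤ → ℤ → R),
    doubleRow s t bs d c f =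
      row s bs c (fun ds c' => row t ds d (fun es d' => f es d' c')) := by
  induction bs with
  | nil => intro d c f; rfl
  | cons b bs ih =>
    intro d c f
    simp only [doubleRow, row, ih, row_vertex]

theorem doubleRow_add (s t : R) (bs : List ℤ) (d c : ℤ) (f g : List ℤ → ℤ → ℤ → R) :
    doubleRow s t bs d c (fun es d' c' => f es d' c' + g es d' c') =
      doubleRow s t bs d c f + doubleRow s t bs d c g := by
  simp only [doubleRow_eq, row_add]

theorem doubleRow_mul (s t : R) (bs : List ℤ) (d c : ℤ) (a : R) (f : List ℤ → ℤ → ℤ → R) :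
    doubleRow s t bs d c (fun es d' c' => a * f es d' c') = a * doubleRow s t bs d c f := by
  simp only [doubleRow_eq, row_mul]

/-- Two carriers crossing the sites, entering with values `d, c` and leaving with values
`d₀ - m, c₀ - m`. -/
noncomputable def twistedRow (s t : R) (m : ℤ) (bs : List ℤ) (f : List ℤ → R)
    (d c d₀ c₀ : ℤ) : R :=
  doubleRow s t bs d c fun es d' c' => if d' = d₀ - m ∧ c' = c₀ - m then f es else 0

theorem twistedRow_diag (s t : R) (m : ℤ) (bs : List ℤ) (f : List ℤ → R) (a : ℤ) :
    (1 + t) * twistedRow s t m bs f a a a a = (1 + t) * twistedRow t s m bs f a a a a := by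
  have h := doubleRow_exchange s t bs
    (fun es d' c' => if d' = a - m ∧ c' = a - m then f es else 0) a a
  have e : (fun es => exchangeOp (1 + t) (s - t)
      ((fun es d' c' => if d' = a - m ∧ c' = a - m then f es else 0) es)) =
      fun es d' c' => (1 + t) * (if d' = a - m ∧ c' = a - m then f es else 0) := by
    funext es d' c'
    simp only [exchangeOp]
    split_ifs <;> first | (exfalso; omega) | ring
  rw [e, doubleRow_mul] at h
  simpa [exchangeOp, twistedRow] using h

theorem twistedRow_swap_of_lt (s t : R) (m : ℤ) (bs : List ℤ) (f : List ℤ → R) {a b : ℤ}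
    (hab : a < b) :
    (1 + s) * (1 + t) * (twistedRow s t m bs f a b a b + twistedRow s t m bs f b a b a) =
    (1 + s) * (1 + t) * (twistedRow t s m bs f a b a b + twistedRow t s m bs f b a b a) := by
  have e1 : (fun es => exchangeOp (1 + t) (s - t)
      ((fun es d' c' => if d' = a - m ∧ c' = b - m then f es else 0) es)) =
      fun es d' c' => (1 + s) * (if d' = a - m ∧ c' = b - m then f es else 0) +
        (s - t) * (if d' = b - m ∧ c' = a - m then f es else 0) := by
    funext es d' c'
    simp only [exchangeOp]
    split_ifs <;> first | (exfalso; omega) | ring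
  have e2 : (fun es => exchangeOp (1 + t) (s - t)
      ((fun es d' c' => if d' = b - m ∧ c' = a - m then f es else 0) es)) =
      fun es d' c' => (1 + t) * (if d' = b - m ∧ c' = a - m then f es else 0) := by
    funext es d' c'
    simp only [exchangeOp]
    split_ifs <;> first | (exfalso; omega) | ring
  have h1 := doubleRow_exchange s t bs
    (fun es d' c' => if d' = a - m ∧ c' = b - m then f es else 0) a b
  have h2 := doubleRow_exchange s t bs
    (fun es d' c' => if d' = b - m ∧ c' = a - m then f es else 0) a b
  have h3 := doubleRow_exchange s t bs
    (fun es d' c' => if d' = b - m ∧ c' = a - m then f es else 0) b a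
  rw [e1, doubleRow_add, doubleRow_mul, doubleRow_mul] at h1
  rw [e2, doubleRow_mul] at h2 h3
  simp only [exchangeOp, hab, if_true, hab.asymm, if_false] at h1 h2 h3
  unfold twistedRow
  linear_combination (1 + t) * h1 + (1 + s) * h3 - (s - t) * h2

theorem sum_twistedRow_comm [IsDomain R] [CharZero R] (s t : R) (hs : 1 + s ≠ 0)
    (ht : 1 + t ≠ 0) (m : ℤ) (bs : List ℤ) (f : List ℤ → R) (G : Finset ℤ) :
    ∑ c ∈ G, ∑ d ∈ G, twistedRow s t m bs f d c d c =
      ∑ c ∈ G, ∑ d ∈ G, twistedRow t s m bs f d c d c := by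
  have key : ∀ a b : ℤ, twistedRow s t m bs f a b a b + twistedRow s t m bs f b a b a =
      twistedRow t s m bs f a b a b + twistedRow t s m bs f b a b a := by
    intro a b
    rcases lt_trichotomy a b with h | rfl | h
    · exact mul_left_cancel₀ (mul_ne_zero hs ht) (twistedRow_swap_of_lt s t m bs f h)
    · rw [mul_left_cancel₀ ht (twistedRow_diag s t m bs f a)]
    · rw [add_comm, add_comm (twistedRow t s m bs f a b a b)]
      exact mul_left_cancel₀ (mul_ne_zero hs ht) (twistedRow_swap_of_lt s t m bs f h)
  have dbl : ∀ u v : R, 2 * ∑ c ∈ G, ∑ d ∈ G, twistedRow u v m bs f d c d c =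
      ∑ c ∈ G, ∑ d ∈ G,
        (twistedRow u v m bs f d c d c + twistedRow u v m bs f c d c d) := by
    intro u v
    simp only [Finset.sum_add_distrib]
    rw [Finset.sum_comm (f := fun c d => twistedRow u v m bs f c d c d)]
    ring
  apply mul_left_cancel₀ (two_ne_zero (α := R))
  rw [dbl, dbl]
  exact Finset.sum_congr rfl fun c _ => Finset.sum_congr rfl fun d _ => key d c

end Transfer

section Circle

variable {R : Type*} [CommRing R]

theorem vertex_eq (s : R) (c b : ℤ) (f : ℤ → ℤ → R) :
    vertex s c b f = f c b + s * (if c ≠ b then f (min c b) (max c b) else 0) := by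
  unfold vertex
  rcases lt_trichotomy c b with h | rfl | h
  · simp [h, h.ne, h.le]
  · simp
  · simp [h, h.ne', h.le, h.asymm]

theorem row_concat (s : R) (b : ℤ) (bs : List ℤ) : ∀ (c : ℤ) (f : List ℤ → ℤ → R),
    row s (bs ++ [b]) c f =
      row s bs c fun ds c' => vertex s c' b fun x c'' => f (ds ++ [x]) c'' := by
  induction bs with
  | nil => intro c f; rfl
  | cons b bs ih => intro c f; simp only [List.cons_append, row, ih]

/-- The values carried past the sites `b 0, b 1, …` by a carrier entering with value `c`, the
larger value being kept exactly at the sites in `B`. -/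
def carried (b : ℕ → ℤ) (B : Finset ℕ) (c : ℤ) : ℕ → ℤ
  | 0 => c
  | i + 1 => if i ∈ B then max (carried b B c i) (b i) else b i

/-- The values dropped by the carrier. -/
def dropped (b : ℕ → ℤ) (B : Finset ℕ) (c : ℤ) (i : ℕ) : ℤ :=
  if i ∈ B then min (carried b B c i) (b i) else carried b B c i

theorem carried_insert (b : ℕ → ℤ) (B : Finset ℕ) (c : ℤ) (m : ℕ) :
    ∀ i ≤ m, carried b (insert m B) c i = carried b B c i := by
  intro i
  induction i with
  | zero => intro _; rfl
  | succ i ih =>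
    intro hi
    simp only [carried, Finset.mem_insert, ih (by omega), show i ≠ m by omega, false_or]

theorem dropped_insert (b : ℕ → ℤ) (B : Finset ℕ) (c : ℤ) (m i : ℕ) (hi : i < m) :
    dropped b (insert m B) c i = dropped b B c i := by
  simp only [dropped, Finset.mem_insert, carried_insert b B c m i hi.le, hi.ne, false_or]

theorem row_eq_sum (s : R) (b : ℕ → ℤ) (c : ℤ) (m : ℕ) : ∀ f : List ℤ → ℤ → R,
    row s ((List.range m).map b) c f =
      ∑ B ∈ (Finset.range m).powerset, s ^ B.card *
        if ∀ j ∈ B, carried b B c j ≠ b j then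
          f ((List.range m).map (dropped b B c)) (carried b B c m) else 0 := by
  induction m with
  | zero => intro f; simp [row, carried]
  | succ m ih =>
    intro f
    rw [List.range_succ, List.map_append, List.map_singleton, row_concat, ih,
      Finset.range_add_one, Finset.sum_powerset_insert Finset.notMem_range_self,
      ← Finset.sum_add_distrib]
    refine Finset.sum_congr rfl fun B hB => ?_
    have hm : m ∉ B := fun h => by simpa using Finset.mem_powerset.1 hB h
    have hlt : ∀ j ∈ B, j < m := fun j h => by simpa using Finset.mem_powerset.1 hB h
    have hd : (List.range m).map (dropped b (insert m B) c) =
        (List.range m).map (dropped b B c) :=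
      List.map_congr_left fun i hi => dropped_insert b B c m i (List.mem_range.1 hi)
    have hall : (∀ j ∈ insert m B, carried b (insert m B) c j ≠ b j) ↔
        (∀ j ∈ B, carried b B c j ≠ b j) ∧ carried b B c m ≠ b m := by
      rw [Finset.forall_mem_insert, carried_insert b B c m m le_rfl, and_comm]
      refine and_congr_left fun _ => forall₂_congr fun j hj => ?_
      rw [carried_insert b B c m j (hlt j hj).le]
    simp only [hall, vertex_eq, Finset.card_insert_of_notMem hm, List.map_append,
      List.map_singleton, hd]
    have e1 : dropped b B c m = carried b B c m := by simp [dropped, hm]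
    have e2 : carried b B c (m + 1) = b m := by simp [carried, hm]
    have e3 : dropped b (insert m B) c m = min (carried b B c m) (b m) := by
      simp [dropped, carried_insert b B c m m le_rfl]
    have e4 : carried b (insert m B) c (m + 1) = max (carried b B c m) (b m) := by
      simp [carried, carried_insert b B c m m le_rfl]
    rw [e1, e2, e3, e4]
    by_cases h1 : ∀ j ∈ B, carried b B c j ≠ b j
    · by_cases h2 : carried b B c m ≠ b m
      · simp only [if_pos h1, if_pos h2, if_pos (And.intro h1 h2)]
        ring
      · simp only [if_pos h1, if_neg h2,
          if_neg (mt And.right h2 : ¬ ((∀ j ∈ B, carried b B c j ≠ b j) ∧ carried b B c m ≠ b m))]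
        ring
    · simp only [if_neg h1,
        if_neg (mt And.left h1 : ¬ ((∀ j ∈ B, carried b B c j ≠ b j) ∧ carried b B c m ≠ b m))]
      ring

theorem carried_eq_or (b : ℕ → ℤ) (B : Finset ℕ) (c : ℤ) (i : ℕ) :
    carried b B c i = c ∨ ∃ j < i, carried b B c i = b j := by
  induction i with
  | zero => exact Or.inl rfl
  | succ i ih =>
    simp only [carried]
    split_ifs with h
    · rcases max_choice (carried b B c i) (b i) with e | e
      · rw [e]
        exact ih.imp id fun ⟨j, hj, h⟩ => ⟨j, by omega, h⟩
      · exact Or.inr ⟨i, by omega, e⟩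
    · exact Or.inr ⟨i, by omega, rfl⟩

theorem carried_congr {b : ℕ → ℤ} {B : Finset ℕ} {i : ℕ} (hi : i ∉ B) (c c' : ℤ) {m : ℕ}
    (hm : i < m) : carried b B c m = carried b B c' m := by
  induction m, hm using Nat.le_induction with
  | base => simp [carried, hi]
  | succ m _ ih => simp [carried, ih]

theorem le_carried {b : ℕ → ℤ} {B : Finset ℕ} (c : ℤ) {m : ℕ} (h : ∀ i < m, i ∈ B) :
    c ≤ carried b B c m := by
  induction m with
  | zero => exact le_rfl
  | succ m ih =>
    simp only [carried, h m (by omega), if_true]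
    exact (ih fun i hi => h i (by omega)).trans (le_max_left _ _)

variable {k : ℕ}

/-- The value found at `j` just before the `j`-th local move, when the local moves indexed by `A`
are performed in cyclic order, at most `m` of them being taken into account. -/
def carryAux (A : Finset (ZMod (k + 1))) (q : ZMod (k + 1) → ℤ) : ℕ → ZMod (k + 1) → ℤ
  | 0, j => q j
  | m + 1, j => if j - 1 ∈ A then max (carryAux A q m (j - 1) + 1) (q j) else q j

/-- The value found at `j` just before the `j`-th local move, when the local moves indexed by `A`
are performed in cyclic order. -/
def carry (A : Finset (ZMod (k + 1))) (q : ZMod (k + 1) → ℤ) : ZMod (k + 1) → ℤ :=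
  carryAux A q (k + 1)

theorem carryAux_stable (A : Finset (ZMod (k + 1))) (q : ZMod (k + 1) → ℤ) (m : ℕ) :
    ∀ j : ZMod (k + 1), (∃ l ≤ m, j - 1 - (l : ZMod (k + 1)) ∉ A) →
      carryAux A q (m + 1) j = carryAux A q m j := by
  induction m with
  | zero =>
    rintro j ⟨l, hl, h⟩
    obtain rfl : l = 0 := by omega
    simp_all [carryAux]
  | succ m ih =>
    rintro j ⟨l, hl, h⟩
    by_cases hj : j - 1 ∈ A
    · obtain _ | l := l
      · simp_all
      · have h' := ih (j - 1) ⟨l, by omega, by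
          rwa [show j - 1 - 1 - (l : ZMod (k + 1)) = j - 1 - ((l + 1 : ℕ) : ZMod (k + 1)) by
            push_cast; ring]⟩
        rw [carryAux, if_pos hj, h', carryAux, if_pos hj]
    · rw [carryAux, if_neg hj, carryAux, if_neg hj]

theorem carry_spec {A : Finset (ZMod (k + 1))} (hA : A ≠ Finset.univ) (q : ZMod (k + 1) → ℤ)
    (j : ZMod (k + 1)) :
    carry A q j = if j - 1 ∈ A then max (carry A q (j - 1) + 1) (q j) else q j := by
  obtain ⟨a, ha⟩ : ∃ a, a ∉ A := by
    by_contra! h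
    exact hA (Finset.eq_univ_iff_forall.2 h)
  have h : carryAux A q (k + 1 + 1) j = carryAux A q (k + 1) j := by
    refine carryAux_stable A q _ j ⟨(j - 1 - a).val, (ZMod.val_lt _).le, ?_⟩
    rwa [ZMod.natCast_zmod_val, sub_sub_cancel]
  rw [carry, ← h, carryAux]

/-- The result of performing the local moves indexed by `A` in cyclic order. -/
def cyclicMove (A : Finset (ZMod (k + 1))) (q : ZMod (k + 1) → ℤ) (j : ZMod (k + 1)) : ℤ :=
  if j ∈ A then min (carry A q j) (q (j + 1) - 1) else carry A q j

/-- The local moves indexed by `A` can be performed in cyclic order. -/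
def Admissible (q : ZMod (k + 1) → ℤ) (A : Finset (ZMod (k + 1))) : Prop :=
  A ≠ Finset.univ ∧ ∀ i ∈ A, carry A q i + 1 ≠ q (i + 1)

/-- The values of `q`, read once around the circle starting at `r` and straightened. -/
def sites (r : ZMod (k + 1)) (z : ℤ) (q : ZMod (k + 1) → ℤ) : List ℤ :=
  (List.range (k + 1)).map fun i : ℕ => q (r + i) - i + z

theorem sites_injective (r : ZMod (k + 1)) (z : ℤ) : Function.Injective (sites r z) := by
  intro q q' h
  funext j
  have h2 := List.map_inj_left.1 h (j - r).val (List.mem_range.2 (ZMod.val_lt _))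
  simp only [ZMod.natCast_zmod_val, add_sub_cancel] at h2
  linarith

theorem carried_sites {A : Finset (ZMod (k + 1))} (hA : A ≠ Finset.univ)
    (q : ZMod (k + 1) → ℤ) (r : ZMod (k + 1)) (z : ℤ) (B : Finset ℕ)
    (hB : ∀ i < k + 1, i ∈ B ↔ r + (i : ZMod (k + 1)) - 1 ∈ A) (i : ℕ) (hi : i ≤ k + 1) :
    carried (fun i : ℕ => q (r + i) - i + z) B (carry A q (r - 1) + 1 + z) i =
      carry A q (r + i - 1) + 1 - i + z := by
  induction i with
  | zero => simp [carried]
  | succ i ih =>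
    rw [carried, ih (by omega)]
    simp only [hB i (by omega)]
    rw [show r + ((i + 1 : ℕ) : ZMod (k + 1)) - 1 = r + i by push_cast; ring]
    rw [carry_spec hA q (r + i)]
    push_cast
    split_ifs
    · rcases le_total (carry A q (r + i - 1) + 1) (q (r + i)) with h | h
      · rw [max_eq_right h, max_eq_right (by linarith)]; ring
      · rw [max_eq_left h, max_eq_left (by linarith)]; ring
    · ring

theorem sum_row_closed (s : R) (q : ZMod (k + 1) → ℤ) (r : ZMod (k + 1)) (z : ℤ)
    (G : Finset ℤ) (hG : ∀ b ∈ sites r z q, b + (k + 1) ∈ G) (F : List ℤ → R) :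
    ∑ c ∈ G, row s (sites r z q) c (fun ds c' => if c' = c - (k + 1) then F ds else 0) =
      ∑ A with Admissible q A, s ^ A.card * F (sites (r - 1) (z + 1) (cyclicMove A q)) := by
  set b : ℕ → ℤ := fun i : ℕ => q (r + i) - i + z with hb
  have hs : sites r z q = (List.range (k + 1)).map b := rfl
  have hinj : ∀ i < k + 1, ∀ j < k + 1,
      r + (i : ZMod (k + 1)) - 1 = r + (j : ZMod (k + 1)) - 1 → i = j := by
    intro i hi j hj h
    have h' : (i : ZMod (k + 1)) = j := by linear_combination h
    rw [ZMod.natCast_eq_natCast_iff'] at h'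
    rwa [Nat.mod_eq_of_lt hi, Nat.mod_eq_of_lt hj] at h'
  have hsurj : ∀ j : ZMod (k + 1), ∃ i < k + 1, r + (i : ZMod (k + 1)) - 1 = j := fun j =>
    ⟨(j - r + 1).val, ZMod.val_lt _, by rw [ZMod.natCast_zmod_val]; ring⟩
  simp only [hs, row_eq_sum]
  rw [Finset.sum_comm, Finset.sum_filter]
  refine Finset.sum_bij'
    (fun B _ => B.image fun i : ℕ => r + (i : ZMod (k + 1)) - 1)
    (fun A _ => (Finset.range (k + 1)).filter fun i : ℕ => r + (i : ZMod (k + 1)) - 1 ∈ A)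
    (fun _ _ => Finset.mem_univ _) (fun _ _ => by simp) ?_ ?_ ?_
  · intro B hB
    have hlt : ∀ j ∈ B, j < k + 1 := fun j h => by simpa using Finset.mem_powerset.1 hB h
    ext i
    simp only [Finset.mem_filter, Finset.mem_range, Finset.mem_image]
    constructor
    · rintro ⟨hi, j, hj, h⟩
      rwa [← hinj j (hlt j hj) i hi h]
    · exact fun h => ⟨hlt i h, i, h, rfl⟩
  · intro A _
    ext j
    simp only [Finset.mem_filter, Finset.mem_range, Finset.mem_image]
    constructor
    · rintro ⟨i, ⟨_, h⟩, rfl⟩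
      exact h
    · intro h
      obtain ⟨i, hi, rfl⟩ := hsurj j
      exact ⟨i, ⟨hi, h⟩, rfl⟩
  · intro B hB
    have hlt : ∀ j ∈ B, j < k + 1 := fun j h => by simpa using Finset.mem_powerset.1 hB h
    set A : Finset (ZMod (k + 1)) := B.image fun i : ℕ => r + (i : ZMod (k + 1)) - 1 with hAdef
    have hBA : ∀ i < k + 1, i ∈ B ↔ r + (i : ZMod (k + 1)) - 1 ∈ A := by
      intro i hi
      simp only [hAdef, Finset.mem_image]
      constructor
      · exact fun h => ⟨i, h, rfl⟩
      · rintro ⟨j, hj, h⟩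
        rwa [← hinj j (hlt j hj) i hi h]
    have hcard : A.card = B.card :=
      Finset.card_image_of_injOn fun i hi j hj h => hinj i (hlt i hi) j (hlt j hj) h
    by_cases hA : A = Finset.univ
    · rw [if_neg fun h => h.1 hA]
      refine Finset.sum_eq_zero fun c _ => ?_
      have hle : c ≤ carried b B c (k + 1) :=
        le_carried c fun i hi => (hBA i hi).2 (hA ▸ Finset.mem_univ _)
      rw [if_neg (show ¬ carried b B c (k + 1) = c - (k + 1) by omega)]
      simp
    · set c₀ : ℤ := carry A q (r - 1) + 1 + z with hc₀
      have hpath := carried_sites hA q r z B hBA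
      have hend : carried b B c₀ (k + 1) = c₀ - (k + 1) := by
        rw [hpath (k + 1) le_rfl]
        have : r + ((k + 1 : ℕ) : ZMod (k + 1)) - 1 = r - 1 := by
          rw [ZMod.natCast_self, add_zero]
        rw [this]
        push_cast
        ring
      obtain ⟨i₀, hi₀, hi₀B⟩ : ∃ i < k + 1, i ∉ B := by
        by_contra! h
        refine hA (Finset.eq_univ_iff_forall.2 fun j => ?_)
        obtain ⟨i, hi, rfl⟩ := hsurj j
        exact (hBA i hi).1 (h i hi)
      have hmem : c₀ ∈ G := by
        rcases carried_eq_or b B c₀ (k + 1) with h | ⟨j, hj, h⟩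
        · omega
        · have := hG (b j) (List.mem_map.2 ⟨j, List.mem_range.2 hj, rfl⟩)
          rwa [← h, hend, sub_add_cancel] at this
      rw [Finset.sum_eq_single_of_mem c₀ hmem]
      · rw [if_pos hend, hcard]
        have hadm : (∀ j ∈ B, carried b B c₀ j ≠ b j) ↔ Admissible q A := by
          simp only [Admissible, ne_eq, hA, not_false_eq_true, true_and]
          constructor
          · intro h i hi
            obtain ⟨i, hi', rfl⟩ := hsurj i
            have h1 := h i ((hBA i hi').2 hi)
            rw [hpath i hi'.le] at h1
            rw [sub_add_cancel]
            intro h2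
            exact h1 (by simp only [hb]; rw [← h2])
          · intro h j hj
            rw [hpath j (hlt j hj).le]
            have h1 := h _ ((hBA j (hlt j hj)).1 hj)
            rw [sub_add_cancel] at h1
            intro h2
            exact h1 (by simp only [hb] at h2; linarith)
        have hdrop : (List.range (k + 1)).map (dropped b B c₀) =
            sites (r - 1) (z + 1) (cyclicMove A q) := by
          refine List.map_congr_left fun i hi => ?_
          have hi := List.mem_range.1 hi
          have e : r - 1 + (i : ZMod (k + 1)) = r + i - 1 := by ring
          simp only [dropped, cyclicMove, e, hBA i hi]
          have hp := hpath i hi.le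
          simp only [← hc₀, ← hb] at hp
          rw [hp, sub_add_cancel]
          simp only [hb]
          split_ifs
          · rcases le_total (carry A q (r + i - 1)) (q (r + i) - 1) with h | h
            · rw [min_eq_left h, min_eq_left (by linarith)]; ring
            · rw [min_eq_right h, min_eq_right (by linarith)]; ring
          · ring
        simp only [hadm, hdrop]
        split_ifs <;> simp
      · intro c _ hc
        have h1 : carried b B c (k + 1) = c₀ - (k + 1) := by
          rw [carried_congr hi₀B c c₀ hi₀, hend]
        rw [if_neg (show ¬ carried b B c (k + 1) = c - (k + 1) by omega)]
        simp

end Circle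

section Commutation

variable {R : Type*} [CommRing R] {k : ℕ}

theorem sum_twistedRow_sites (s t : R) (q : ZMod (k + 1) → ℤ) (f : List ℤ → R) (G : Finset ℤ)
    (hG : ∀ b ∈ sites 0 0 q, b + (k + 1) ∈ G)
    (hG' : ∀ A : Finset (ZMod (k + 1)), ∀ b ∈ sites (0 - 1) (0 + 1) (cyclicMove A q),
      b + (k + 1) ∈ G) :
    ∑ c ∈ G, ∑ d ∈ G, twistedRow s t (k + 1) (sites 0 0 q) f d c d c =
      ∑ A with Admissible q A, s ^ A.card * ∑ B with Admissible (cyclicMove A q) B,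
        t ^ B.card * f (sites (0 - 1 - 1) (0 + 1 + 1) (cyclicMove B (cyclicMove A q))) := by
  have h1 : ∀ c : ℤ, ∑ d ∈ G, twistedRow s t (k + 1) (sites 0 0 q) f d c d c =
      row s (sites 0 0 q) c (fun ds c' => if c' = c - (k + 1) then
        ∑ d ∈ G, row t ds d (fun es d' => if d' = d - (k + 1) then f es else 0) else 0) := by
    intro c
    simp only [twistedRow, doubleRow_eq, ← row_sum]
    congr 1
    funext ds c'
    split_ifs with h
    · simp [h]
    · simp [h, row_zero]
  simp only [h1]
  rw [sum_row_closed s q 0 0 G hG fun ds =>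
    ∑ d ∈ G, row t ds d fun es d' => if d' = d - (k + 1) then f es else 0]
  refine Finset.sum_congr rfl fun A _ => ?_
  rw [sum_row_closed t (cyclicMove A q) (0 - 1) (0 + 1) G (hG' A) f]

theorem sum_cyclicMove_comm [IsDomain R] [CharZero R] (s t : R) (hs : 1 + s ≠ 0)
    (ht : 1 + t ≠ 0) (q : ZMod (k + 1) → ℤ) (F : (ZMod (k + 1) → ℤ) → R) :
    ∑ A with Admissible q A, s ^ A.card * ∑ B with Admissible (cyclicMove A q) B,
        t ^ B.card * F (cyclicMove B (cyclicMove A q)) =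
      ∑ A with Admissible q A, t ^ A.card * ∑ B with Admissible (cyclicMove A q) B,
        s ^ B.card * F (cyclicMove B (cyclicMove A q)) := by
  set f : List ℤ → R := Function.extend (sites (0 - 1 - 1) (0 + 1 + 1)) F 0 with hf
  have hfF : ∀ q', f (sites (0 - 1 - 1) (0 + 1 + 1) q') = F q' := fun q' =>
    (sites_injective _ _).extend_apply F 0 q'
  set G : Finset ℤ := ((sites 0 0 q).map (· + ((k : ℤ) + 1))).toFinset ∪
    Finset.univ.biUnion fun A : Finset (ZMod (k + 1)) =>
      ((sites (0 - 1) (0 + 1) (cyclicMove A q)).map (· + ((k : ℤ) + 1))).toFinset with hGdef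
  have hG : ∀ b ∈ sites 0 0 q, b + ((k : ℤ) + 1) ∈ G := fun b hb =>
    Finset.mem_union_left _ (List.mem_toFinset.2 (List.mem_map_of_mem hb))
  have hG' : ∀ A : Finset (ZMod (k + 1)), ∀ b ∈ sites (0 - 1) (0 + 1) (cyclicMove A q),
      b + ((k : ℤ) + 1) ∈ G := fun A b hb =>
    Finset.mem_union_right _ (Finset.mem_biUnion.2
      ⟨A, Finset.mem_univ _, List.mem_toFinset.2 (List.mem_map_of_mem hb)⟩)
  have h := sum_twistedRow_comm s t hs ht (k + 1) (sites 0 0 q) f G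
  rw [sum_twistedRow_sites s t q f G hG hG', sum_twistedRow_sites t s q f G hG hG'] at h
  simpa only [hfF] using h

open Polynomial in
theorem sum_card_cyclicMove_comm (q : ZMod (k + 1) → ℤ) (F : (ZMod (k + 1) → ℤ) → ℕ)
    (a b : ℕ) :
    ∑ A with Admissible q A ∧ A.card = a, ∑ B with Admissible (cyclicMove A q) B ∧ B.card = b,
        F (cyclicMove B (cyclicMove A q)) =
      ∑ A with Admissible q A ∧ A.card = b, ∑ B with Admissible (cyclicMove A q) B ∧ B.card = a,
        F (cyclicMove B (cyclicMove A q)) := by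
  have hX : (1 : ℤ[X][X]) + X ≠ 0 := fun h => by
    simpa [coeff_one, coeff_X] using congrArg (fun p => p.coeff 1) h
  have hC : (1 : ℤ[X][X]) + C X ≠ 0 := fun h => by
    have h1 := congrArg (fun p => (p.coeff 0).coeff 1) h
    simp [coeff_one, coeff_X] at h1
  have h := congrArg (fun p => (p.coeff b).coeff a) (sum_cyclicMove_comm (C X : ℤ[X][X]) X hC hX q
    fun q' => C (C (F q' : ℤ)))
  have e1 : ∀ (m n : ℕ) (z : ℤ), (((C X : ℤ[X][X]) ^ m * (X ^ n * C (C z))).coeff b).coeff a =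
      if m = a ∧ n = b then z else 0 := by
    intro m n z
    rw [show (C X : ℤ[X][X]) ^ m * (X ^ n * C (C z)) = C (C z * X ^ m) * X ^ n by
      simp only [map_mul, map_pow]; ring, coeff_C_mul_X_pow]
    split_ifs with h1 h2 h2
    · rw [coeff_C_mul_X_pow, if_pos h2.1.symm]
    · rw [coeff_C_mul_X_pow, if_neg fun h => h2 ⟨h.symm, h1.symm⟩]
    · exact absurd h2.2.symm h1
    · simp
  have e2 : ∀ (m n : ℕ) (z : ℤ), (((X : ℤ[X][X]) ^ m * ((C X) ^ n * C (C z))).coeff b).coeff a =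
      if m = b ∧ n = a then z else 0 := by
    intro m n z
    rw [show (X : ℤ[X][X]) ^ m * ((C X) ^ n * C (C z)) = (C X) ^ n * (X ^ m * C (C z)) by ring,
      e1]
    simp only [and_comm]
  simp only [Finset.mul_sum, finsetSum_coeff, e1, e2] at h
  have e3 : ∀ a b : ℕ, ((∑ A with Admissible q A ∧ A.card = a,
      ∑ B with Admissible (cyclicMove A q) B ∧ B.card = b,
        F (cyclicMove B (cyclicMove A q)) : ℕ) : ℤ) =
      ∑ A with Admissible q A, ∑ B with Admissible (cyclicMove A q) B,
        if A.card = a ∧ B.card = b then (F (cyclicMove B (cyclicMove A q)) : ℤ) else 0 := by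
    intro a b
    push_cast
    rw [← Finset.filter_filter, Finset.sum_filter]
    refine Finset.sum_congr rfl fun A _ => ?_
    rw [← Finset.filter_filter, Finset.sum_filter]
    split_ifs with h
    · simp [h]
    · simp [h]
  have := (e3 a b).trans (h.trans (e3 b a).symm)
  exact_mod_cast this

/-- The number of ways to reach `q'` from `q` by successive cyclic moves of the given sizes. -/
noncomputable def moveCount : List ℕ → (ZMod (k + 1) → ℤ) → (ZMod (k + 1) → ℤ) → ℕ
  | [], q, q' => if q = q' then 1 else 0
  | a :: α, q, q' => ∑ A with Admissible q A ∧ A.card = a, moveCount α (cyclicMove A q) q'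

theorem moveCount_perm {α β : List ℕ} (h : α.Perm β) (q' : ZMod (k + 1) → ℤ) :
    ∀ q, moveCount α q q' = moveCount β q q' := by
  induction h with
  | nil => exact fun _ => rfl
  | cons a _ ih => exact fun q => Finset.sum_congr rfl fun A _ => ih _
  | swap a b α =>
    exact fun q => sum_card_cyclicMove_comm q (fun q'' => moveCount α q'' q') b a
  | trans _ _ ih₁ ih₂ => exact fun q => (ih₁ q).trans (ih₂ q)

end Commutation

section Words

variable {k : ℕ}

/-- The local move at `i`, exchanging the positions of the classes `i` and `i + 1`
when this is an increase. -/
def move (i : ZMod (k + 1)) (q : ZMod (k + 1) → ℤ) (j : ZMod (k + 1)) : ℤ :=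
  if j = i then min (q i) (q (i + 1) - 1)
  else if j = i + 1 then max (q i + 1) (q (i + 1)) else q j

/-- The result of a sequence of local moves. -/
def run (q : ZMod (k + 1) → ℤ) (w : List (ZMod (k + 1))) : ZMod (k + 1) → ℤ :=
  w.foldl (fun q i => move i q) q

/-- None of the successive local moves is stationary. -/
def Valid : (ZMod (k + 1) → ℤ) → List (ZMod (k + 1)) → Prop
  | _, [] => True
  | q, i :: w => q i + 1 ≠ q (i + 1) ∧ Valid (move i q) w

/-- The successive local moves, each together with the raised value it leaves behind. -/
def trace : (ZMod (k + 1) → ℤ) → List (ZMod (k + 1)) → List (ZMod (k + 1) × ℤ)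
  | _, [] => []
  | q, i :: w => (i, move i q (i + 1)) :: trace (move i q) w

/-- The compatibility required of two moves occurring in this order within one block. -/
def BlockRel (a b : ZMod (k + 1) × ℤ) : Prop :=
  a.1 ≠ b.1 ∧ a.1 ≠ b.1 + 1 ∧ a.2 < b.2

/-- The word `w` splits into blocks of the sizes prescribed by `α`, with compatible moves
inside each block. -/
def GoodWord : List ℕ → (ZMod (k + 1) → ℤ) → List (ZMod (k + 1)) → Prop
  | [], _, w => w = []
  | a :: α, q, w => a ≤ w.length ∧ Valid q (w.take a) ∧
      (trace q (w.take a)).Pairwise BlockRel ∧ GoodWord α (run q (w.take a)) (w.drop a)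

/-- Each entry of `q` is congruent to its index. -/
def Cong (q : ZMod (k + 1) → ℤ) : Prop :=
  ∀ j, (q j : ZMod (k + 1)) = j

theorem Cong.carry {q : ZMod (k + 1) → ℤ} (hq : Cong q) (A : Finset (ZMod (k + 1))) :
    Cong (carry A q) := by
  have h : ∀ m, Cong (carryAux A q m) := by
    intro m
    induction m with
    | zero => exact hq
    | succ m ih =>
      intro j
      simp only [carryAux]
      split_ifs
      · rcases max_choice (carryAux A q m (j - 1) + 1) (q j) with h | h <;> rw [h]
        · push_cast
          rw [ih (j - 1), sub_add_cancel]
        · exact hq j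
      · exact hq j
  exact h _

theorem Cong.cyclicMove {q : ZMod (k + 1) → ℤ} (hq : Cong q) (A : Finset (ZMod (k + 1))) :
    Cong (cyclicMove A q) := by
  intro j
  simp only [AffineKTheory.cyclicMove]
  split_ifs
  · rcases min_choice (AffineKTheory.carry A q j) (q (j + 1) - 1) with h | h <;> rw [h]
    · exact hq.carry A j
    · push_cast
      rw [hq (j + 1), add_sub_cancel_right]
  · exact hq.carry A j

theorem Cong.injective {q : ZMod (k + 1) → ℤ} (hq : Cong q) : Function.Injective q := by
  intro i j h
  rw [← hq i, h, hq j]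

/-- The state reached when the moves in `U`, among those in `A`, have been performed. -/
noncomputable def partialMove (A : Finset (ZMod (k + 1))) (q : ZMod (k + 1) → ℤ)
    (U : Finset (ZMod (k + 1))) (j : ZMod (k + 1)) : ℤ :=
  if j ∈ U then min (carry A q j) (q (j + 1) - 1) else if j - 1 ∈ U then carry A q j else q j

theorem partialMove_empty (A : Finset (ZMod (k + 1))) (q : ZMod (k + 1) → ℤ) :
    partialMove A q ∅ = q := by
  funext j
  simp [partialMove]

theorem partialMove_self {A : Finset (ZMod (k + 1))} (hA : A ≠ Finset.univ)
    (q : ZMod (k + 1) → ℤ) : partialMove A q A = cyclicMove A q := by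
  funext j
  simp only [partialMove, cyclicMove]
  split_ifs with h1 h2
  · rfl
  · rfl
  · rw [carry_spec hA, if_neg h2]

theorem add_one_ne (hk : 1 ≤ k) (i : ZMod (k + 1)) : i + 1 ≠ i := by
  have : Fact (1 < k + 1) := ⟨by omega⟩
  intro h
  exact one_ne_zero (α := ZMod (k + 1)) (by linear_combination h)

theorem partialMove_apply_self {A : Finset (ZMod (k + 1))} (hA : A ≠ Finset.univ)
    (q : ZMod (k + 1) → ℤ) {U : Finset (ZMod (k + 1))} (i : ZMod (k + 1))
    (hi : i ∉ U) (hi' : i - 1 ∈ A → i - 1 ∈ U) : partialMove A q U i = carry A q i := by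
  rw [partialMove, if_neg hi]
  split_ifs with h
  · rfl
  · rw [carry_spec hA, if_neg fun h' => h (hi' h')]

theorem partialMove_apply_succ {A : Finset (ZMod (k + 1))} (q : ZMod (k + 1) → ℤ)
    {U : Finset (ZMod (k + 1))} (i : ZMod (k + 1)) (hi : i ∉ U) (hi' : i + 1 ∉ U) :
    partialMove A q U (i + 1) = q (i + 1) := by
  rw [partialMove, if_neg hi', add_sub_cancel_right, if_neg hi]

theorem move_partialMove {A : Finset (ZMod (k + 1))} (hA : A ≠ Finset.univ)
    (q : ZMod (k + 1) → ℤ) {U : Finset (ZMod (k + 1))} {i : ZMod (k + 1)} (hiA : i ∈ A)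
    (hi : i ∉ U) (hi' : i + 1 ∉ U) (hi'' : i - 1 ∈ A → i - 1 ∈ U) :
    move i (partialMove A q U) = partialMove A q (insert i U) := by
  funext j
  have e1 := partialMove_apply_self hA q i hi hi''
  have e2 := partialMove_apply_succ (A := A) q i hi hi'
  rw [move, e1, e2]
  by_cases h1 : j = i
  · subst h1
    simp [partialMove]
  · by_cases h2 : j = i + 1
    · subst h2
      simp [partialMove, h1, hi', carry_spec hA q (i + 1), hiA]
    · have h3 : j - 1 ≠ i := fun h => h2 (by rw [← h, sub_add_cancel])
      simp [partialMove, h1, h2, h3]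

theorem run_partialMove (hk : 1 ≤ k) {A : Finset (ZMod (k + 1))} (hA : A ≠ Finset.univ)
    (q : ZMod (k + 1) → ℤ) (v : List (ZMod (k + 1))) : ∀ U : Finset (ZMod (k + 1)),
    U ∪ v.toFinset = A → (∀ j ∈ U, ∀ i ∈ v, j ≠ i ∧ j ≠ i + 1) →
    v.Pairwise (fun a b => a ≠ b ∧ a ≠ b + 1) →
    run (partialMove A q U) v = cyclicMove A q ∧
    (Valid (partialMove A q U) v ↔ ∀ i ∈ v, carry A q i + 1 ≠ q (i + 1)) ∧
    trace (partialMove A q U) v = v.map fun i => (i, carry A q (i + 1)) := by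
  induction v with
  | nil =>
    intro U hU _ _
    have : U = A := by simpa using hU
    subst this
    simp [run, partialMove_self hA, Valid, trace]
  | cons i v ih =>
    intro U hU hsep hp
    rw [List.pairwise_cons] at hp
    have hiA : i ∈ A := hU ▸ by simp
    have hi : i ∉ U := fun h => (hsep i h i (by simp)).1 rfl
    have hi' : i + 1 ∉ U := fun h => (hsep _ h i (by simp)).2 rfl
    have hi'' : i - 1 ∈ A → i - 1 ∈ U := by
      rw [← hU]
      simp only [Finset.mem_union, List.toFinset_cons, Finset.mem_insert, List.mem_toFinset]
      rintro (h | h | h)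
      · exact h
      · exact absurd (by linear_combination -h) (add_one_ne hk i)
      · exact absurd (sub_add_cancel i 1).symm (hp.1 _ h).2
    have hm := move_partialMove hA q hiA hi hi' hi''
    have e1 := partialMove_apply_self hA q i hi hi''
    have e2 := partialMove_apply_succ (A := A) q i hi hi'
    obtain ⟨h1, h2, h3⟩ := ih (insert i U)
      (by rw [← hU]; ext; simp)
      (by
        intro j hj l hl
        rcases Finset.mem_insert.1 hj with rfl | hj
        · exact hp.1 l hl
        · exact hsep j hj l (by simp [hl])) hp.2
    refine ⟨?_, ?_, ?_⟩
    · rw [run, List.foldl_cons, hm]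
      exact h1
    · rw [Valid, hm, h2, e1, e2, List.forall_mem_cons]
    · rw [trace, hm, h3, List.map_cons]
      congr 2
      simp [partialMove, hi', add_one_ne hk i]

theorem lt_carry {A : Finset (ZMod (k + 1))} (hA : A ≠ Finset.univ) (q : ZMod (k + 1) → ℤ)
    {i : ZMod (k + 1)} (hi : i ∈ A) : carry A q i < carry A q (i + 1) := by
  rw [carry_spec hA q (i + 1), add_sub_cancel_right, if_pos hi]
  exact lt_of_lt_of_le (lt_add_one _) (le_max_left _ _)

/-- The moves in `A`, in the order in which a block performs them. -/
noncomputable def moveOrder (A : Finset (ZMod (k + 1))) (q : ZMod (k + 1) → ℤ) :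
    List (ZMod (k + 1)) :=
  ((A.image fun i => carry A q (i + 1)).sort (· ≤ ·)).map fun v : ℤ => (v : ZMod (k + 1)) - 1

theorem eq_moveOrder_iff {A : Finset (ZMod (k + 1))} {q : ZMod (k + 1) → ℤ} (hq : Cong q)
    {u : List (ZMod (k + 1))} : u = moveOrder A q ↔
      u.toFinset = A ∧ u.Pairwise (fun a b => carry A q (a + 1) < carry A q (b + 1)) := by
  have hback : ∀ i, ((carry A q (i + 1) : ℤ) : ZMod (k + 1)) - 1 = i := fun i => by
    rw [hq.carry A, add_sub_cancel_right]
  constructor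
  · rintro rfl
    constructor
    · ext i
      simp only [moveOrder, List.mem_toFinset, List.mem_map, Finset.mem_sort, Finset.mem_image]
      constructor
      · rintro ⟨_, ⟨j, hj, rfl⟩, rfl⟩
        rwa [hback]
      · exact fun h => ⟨_, ⟨i, h, rfl⟩, hback i⟩
    · rw [moveOrder, List.pairwise_map]
      refine (Finset.sortedLT_sort _).pairwise.imp_of_mem ?_
      intro a b ha hb hab
      simp only [Finset.mem_sort, Finset.mem_image] at ha hb
      obtain ⟨i, _, rfl⟩ := ha
      obtain ⟨j, _, rfl⟩ := hb
      rwa [hback, hback]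
  · rintro ⟨rfl, h⟩
    set A := u.toFinset
    have h1 : (u.map fun i => carry A q (i + 1)).Pairwise (· < ·) := List.pairwise_map.2 h
    have h2 : (A.image fun i => carry A q (i + 1)) =
        (u.map fun i => carry A q (i + 1)).toFinset := by
      ext; simp [A]
    have h3 : (A.image fun i => carry A q (i + 1)).sort (· ≤ ·) =
        u.map fun i => carry A q (i + 1) := by
      rw [h2, List.toFinset_sort _ (h1.imp ne_of_lt)]
      exact h1.imp le_of_lt
    rw [moveOrder, h3, List.map_map]
    conv_lhs => rw [← List.map_id u]
    exact List.map_congr_left fun i _ => (hback i).symm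

theorem block_iff (hk : 1 ≤ k) {q : ZMod (k + 1) → ℤ} (hq : Cong q) {a : ℕ} (ha : a ≤ k)
    (u : List (ZMod (k + 1))) :
    (u.length = a ∧ Valid q u ∧ (trace q u).Pairwise BlockRel) ↔
      ∃ A, (Admissible q A ∧ A.card = a) ∧ u = moveOrder A q := by
  have hcard : u.length = a → u.toFinset ≠ Finset.univ := by
    intro h h'
    have h1 := u.toFinset_card_le
    rw [h', Finset.card_univ, ZMod.card] at h1
    omega
  have main : u.length = a → u.Pairwise (fun a b => a ≠ b ∧ a ≠ b + 1) →
      (Valid q u ↔ Admissible q u.toFinset) ∧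
      trace q u = u.map fun i => (i, carry u.toFinset q (i + 1)) := by
    intro h hp
    obtain ⟨-, h2, h3⟩ := run_partialMove hk (hcard h) q u ∅ (by simp) (by simp) hp
    rw [partialMove_empty] at h2 h3
    refine ⟨?_, h3⟩
    rw [h2, Admissible, and_iff_right (hcard h)]
    simp
  constructor
  · rintro ⟨hl, hv, hb⟩
    have hfst : ∀ (q : ZMod (k + 1) → ℤ) (u : List (ZMod (k + 1))),
        (trace q u).map Prod.fst = u := by
      intro q u
      induction u generalizing q with
      | nil => rfl
      | cons i u ih => simp [trace, ih]
    have hp : u.Pairwise (fun a b => a ≠ b ∧ a ≠ b + 1) := by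
      rw [← hfst q u, List.pairwise_map]
      exact hb.imp fun h => ⟨h.1, h.2.1⟩
    obtain ⟨h1, h2⟩ := main hl hp
    refine ⟨u.toFinset, ⟨h1.1 hv, ?_⟩, (eq_moveOrder_iff hq).2 ⟨rfl, ?_⟩⟩
    · rw [List.toFinset_card_of_nodup (hp.imp And.left), hl]
    · rw [h2, List.pairwise_map] at hb
      exact hb.imp fun h => h.2.2
  · rintro ⟨A, ⟨hadm, hc⟩, hu⟩
    obtain ⟨rfl, hlt⟩ := (eq_moveOrder_iff hq).1 hu
    have hp : u.Pairwise (fun a b => a ≠ b ∧ a ≠ b + 1) := by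
      refine hlt.imp_of_mem fun {a b} ha hb h => ⟨fun e => by simp [e] at h, fun e => ?_⟩
      have h1 := lt_carry hadm.1 q (List.mem_toFinset.2 ha)
      rw [e] at h1 h
      omega
    have hl : u.length = a := by
      rw [← hc, List.toFinset_card_of_nodup (hp.imp And.left)]
    obtain ⟨h1, h2⟩ := main hl hp
    refine ⟨hl, h1.2 hadm, ?_⟩
    rw [h2, List.pairwise_map]
    exact (hp.and hlt).imp fun h => ⟨h.1.1, h.1.2, h.2⟩

theorem length_moveOrder {q : ZMod (k + 1) → ℤ} (hq : Cong q) (A : Finset (ZMod (k + 1))) :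
    (moveOrder A q).length = A.card := by
  rw [moveOrder, List.length_map, Finset.length_sort, Finset.card_image_of_injective]
  exact (hq.carry A).injective.comp (add_left_injective 1)

theorem run_moveOrder (hk : 1 ≤ k) {q : ZMod (k + 1) → ℤ} (hq : Cong q)
    {A : Finset (ZMod (k + 1))} (hA : A ≠ Finset.univ) :
    run q (moveOrder A q) = cyclicMove A q := by
  obtain ⟨h, hlt⟩ := (eq_moveOrder_iff hq).1 (rfl : moveOrder A q = _)
  have := (run_partialMove hk hA q (moveOrder A q) ∅ (by simp [h]) (by simp) ?_).1
  · rwa [partialMove_empty] at this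
  · refine hlt.imp_of_mem fun {a b} ha hb h' => ⟨fun e => by simp [e] at h', fun e => ?_⟩
    have h1 := lt_carry hA q (h ▸ List.mem_toFinset.2 ha)
    rw [e] at h1 h'
    omega

/-- The good words with block sizes `α` leading from `q` to `q'`. -/
noncomputable def goodWords : List ℕ → (ZMod (k + 1) → ℤ) → (ZMod (k + 1) → ℤ) →
    Finset (List (ZMod (k + 1)))
  | [], q, q' => if q = q' then {[]} else ∅
  | a :: α, q, q' => ({A | Admissible q A ∧ A.card = a} : Finset _).biUnion fun A =>
      (goodWords α (cyclicMove A q) q').image (moveOrder A q ++ ·)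

theorem card_goodWords (α : List ℕ) (q' : ZMod (k + 1) → ℤ) :
    ∀ q : ZMod (k + 1) → ℤ, Cong q → (goodWords α q q').card = moveCount α q q' := by
  induction α with
  | nil =>
    intro q _
    simp only [goodWords, moveCount]
    split_ifs <;> rfl
  | cons a α ih =>
    intro q hq
    rw [goodWords, moveCount, Finset.card_biUnion]
    · refine Finset.sum_congr rfl fun A _ => ?_
      rw [Finset.card_image_of_injective _ (List.append_right_injective _), ih _ (hq.cyclicMove A)]
    · intro A hA B hB hAB
      rw [Function.onFun, Finset.disjoint_left]
      intro w h1 h2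
      obtain ⟨v, _, rfl⟩ := Finset.mem_image.1 h1
      obtain ⟨v', _, h⟩ := Finset.mem_image.1 h2
      have hlen : (moveOrder B q).length = (moveOrder A q).length := by
        rw [length_moveOrder hq, length_moveOrder hq, (Finset.mem_filter.1 hA).2.2,
          (Finset.mem_filter.1 hB).2.2]
      have e := (List.append_inj h hlen).1
      refine hAB ?_
      rw [← ((eq_moveOrder_iff hq).1 (rfl : moveOrder A q = _)).1,
        ← ((eq_moveOrder_iff hq).1 (rfl : moveOrder B q = _)).1, e]

theorem mem_goodWords (hk : 1 ≤ k) {α : List ℕ} (q' : ZMod (k + 1) → ℤ) :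
    (∀ a ∈ α, a ≤ k) → ∀ (q : ZMod (k + 1) → ℤ) (w : List (ZMod (k + 1))), Cong q →
      (w ∈ goodWords α q q' ↔ GoodWord α q w ∧ run q w = q') := by
  induction α with
  | nil =>
    intro _ q w _
    simp only [goodWords, GoodWord]
    split_ifs with h
    · simp only [Finset.mem_singleton]
      refine ⟨?_, And.left⟩
      rintro rfl
      exact ⟨rfl, h⟩
    · simp only [Finset.notMem_empty, false_iff]
      rintro ⟨rfl, h'⟩
      exact h h'
  | cons a α ih =>
    intro hα q w hq
    have ih := ih fun b hb => hα b (List.mem_cons_of_mem _ hb)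
    have hblock := block_iff hk hq (hα a List.mem_cons_self)
    simp only [goodWords, GoodWord, Finset.mem_biUnion, Finset.mem_filter, Finset.mem_univ,
      true_and, Finset.mem_image]
    constructor
    · rintro ⟨A, hA, v, hv, rfl⟩
      obtain ⟨h1, h2, h3⟩ := (hblock (moveOrder A q)).2 ⟨A, hA, rfl⟩
      rw [ih _ _ (hq.cyclicMove A)] at hv
      have e := run_moveOrder hk hq hA.1.1
      rw [List.take_left' h1, List.drop_left' h1]
      refine ⟨⟨by simp [h1], h2, h3, by rw [e]; exact hv.1⟩, ?_⟩
      rw [run, List.foldl_append]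
      rw [run] at e
      rw [e]
      exact hv.2
    · rintro ⟨⟨h1, h2, h3, h4⟩, h5⟩
      obtain ⟨A, hA, hu⟩ := (hblock (w.take a)).1 ⟨by simp [h1], h2, h3⟩
      have e := run_moveOrder hk hq hA.1.1
      refine ⟨A, hA, w.drop a, ?_, by rw [← hu, List.take_append_drop]⟩
      rw [ih _ _ (hq.cyclicMove A), ← e, ← hu]
      refine ⟨h4, ?_⟩
      rw [run, run, ← List.foldl_append, List.take_append_drop]
      exact h5

end Words

section Beads

variable {k : ℕ} {γ : YoungDiagram}

theorem mem_rowLen_iff_colLen (γ : YoungDiagram) (r c : ℕ) : c < γ.rowLen r ↔ r < γ.colLen c := by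
  rw [← YoungDiagram.mem_iff_lt_rowLen, YoungDiagram.mem_iff_lt_colLen]

theorem addable_iff {r c : ℕ} : Addable γ (r, c) ↔ γ.rowLen r = c ∧ γ.colLen c = r := by
  constructor
  · rintro ⟨h1, h2⟩
    have h1' := h1
    rw [YoungDiagram.mem_iff_lt_rowLen] at h1
    rw [YoungDiagram.mem_iff_lt_colLen] at h1'
    constructor
    · rcases Nat.eq_zero_or_pos c with rfl | hc
      · omega
      · have := h2 (r, c - 1) (by simp) (by simp; omega)
        rw [YoungDiagram.mem_iff_lt_rowLen] at this
        omega
    · rcases Nat.eq_zero_or_pos r with rfl | hc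
      · omega
      · have := h2 (r - 1, c) (by simp) (by simp; omega)
        rw [YoungDiagram.mem_iff_lt_colLen] at this
        omega
  · rintro ⟨h1, h2⟩
    refine ⟨by rw [YoungDiagram.mem_iff_lt_rowLen]; omega, ?_⟩
    rintro ⟨a, b⟩ ⟨ha, hb⟩ hne
    simp only at ha hb
    rcases hb.lt_or_eq with hb | rfl
    · exact γ.up_left_mem ha le_rfl (YoungDiagram.mem_iff_lt_rowLen.2 (by omega))
    · rw [YoungDiagram.mem_iff_lt_colLen, h2]
      exact ha.lt_of_ne fun h => hne (by rw [h])

theorem removable_iff {r c : ℕ} :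
    Removable γ (r, c) ↔ γ.rowLen r = c + 1 ∧ γ.colLen c = r + 1 := by
  have h := mem_rowLen_iff_colLen γ r c
  simp only [Removable]
  rw [YoungDiagram.mem_iff_lt_rowLen, YoungDiagram.mem_iff_lt_rowLen (j := c + 1),
    YoungDiagram.mem_iff_lt_colLen]
  omega

/-- The vertical steps of the boundary of `γ`, indexed by their position. -/
def Bead (γ : YoungDiagram) (p : ℤ) : Prop :=
  ∃ r : ℕ, (γ.rowLen r : ℤ) = r + p

theorem not_bead_iff {p : ℤ} : ¬ Bead γ p ↔ ∃ c : ℕ, (γ.colLen c : ℤ) = c + 1 - p := by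
  constructor
  · intro h
    have hex : ∃ r : ℕ, (γ.rowLen r : ℤ) ≤ r + p := by
      refine ⟨γ.rowLen 0 + p.natAbs, ?_⟩
      have := γ.rowLen_anti 0 (γ.rowLen 0 + p.natAbs) (Nat.zero_le _)
      push_cast
      have := neg_abs_le p
      omega
    have hr := Nat.find_spec hex
    have hmin : ∀ m < Nat.find hex, ¬ (γ.rowLen m : ℤ) ≤ m + p := fun m hm => Nat.find_min hex hm
    set r := Nat.find hex
    have hne : (γ.rowLen r : ℤ) ≠ r + p := fun h' => h ⟨r, h'⟩
    refine ⟨(r + p - 1).toNat, ?_⟩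
    have h1 := mem_rowLen_iff_colLen γ r (r + p - 1).toNat
    rcases Nat.eq_zero_or_pos r with h0 | h0
    · omega
    · have h2 := mem_rowLen_iff_colLen γ (r - 1) (r + p - 1).toNat
      have h3 := hmin (r - 1) (by omega)
      omega
  · rintro ⟨c, hc⟩ ⟨r, hr⟩
    have := mem_rowLen_iff_colLen γ r c
    omega

theorem bead_of_removable {r c : ℕ} (h : Removable γ (r, c)) {p : ℤ} (hp : (c : ℤ) = r + p) :
    ¬ Bead γ p ∧ Bead γ (p + 1) := by
  rw [removable_iff] at h
  exact ⟨not_bead_iff.2 ⟨c, by omega⟩, r, by omega⟩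

theorem exists_removable {p : ℤ} (h : ¬ Bead γ p) (h' : Bead γ (p + 1)) :
    ∃ r c : ℕ, Removable γ (r, c) ∧ (c : ℤ) = r + p := by
  obtain ⟨c, hc⟩ := not_bead_iff.1 h
  obtain ⟨r, hr⟩ := h'
  have := mem_rowLen_iff_colLen γ r c
  exact ⟨r, c, removable_iff.2 (by omega), by omega⟩

theorem bead_of_addable {r c : ℕ} (h : Addable γ (r, c)) {p : ℤ} (hp : (c : ℤ) = r + p) :
    Bead γ p ∧ ¬ Bead γ (p + 1) := by
  rw [addable_iff] at h
  exact ⟨⟨r, by omega⟩, not_bead_iff.2 ⟨c, by omega⟩⟩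

theorem exists_addable {p : ℤ} (h : Bead γ p) (h' : ¬ Bead γ (p + 1)) :
    ∃ r c : ℕ, Addable γ (r, c) ∧ (c : ℤ) = r + p := by
  obtain ⟨c, hc⟩ := not_bead_iff.1 h'
  obtain ⟨r, hr⟩ := h
  have := mem_rowLen_iff_colLen γ r c
  exact ⟨r, c, addable_iff.2 (by omega), by omega⟩

theorem isCore_iff (n : ℕ) : IsCore n γ ↔ ∀ p, Bead γ p → Bead γ (p - n) := by
  constructor
  · rintro h p ⟨r, hr⟩
    by_contra hc
    obtain ⟨c, hc⟩ := not_bead_iff.1 hc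
    have h1 := mem_rowLen_iff_colLen γ r c
    refine h (r, c) (YoungDiagram.mem_iff_lt_rowLen.2 (by omega)) ?_
    simp only [hookLen]
    omega
  · rintro h ⟨r, c⟩ hc hh
    simp only [hookLen] at hh
    have h1 := YoungDiagram.mem_iff_lt_rowLen.1 hc
    have h2 := YoungDiagram.mem_iff_lt_colLen.1 hc
    refine not_bead_iff.2 ⟨c, ?_⟩ (h (γ.rowLen r - r) ⟨r, by ring⟩)
    omega

theorem eq_of_bead_iff {γ δ : YoungDiagram} (h : ∀ p, Bead γ p ↔ Bead δ p) : γ = δ := by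
  have hmono : ∀ γ : YoungDiagram, StrictMono fun r : ℕ => (r : ℤ) - γ.rowLen r := by
    intro γ
    refine strictMono_nat_of_lt_succ fun r => ?_
    have := γ.rowLen_anti r (r + 1) (Nat.le_succ r)
    push_cast
    omega
  have hr : (Set.range fun r : ℕ => (r : ℤ) - γ.rowLen r) =
      Set.range fun r : ℕ => (r : ℤ) - δ.rowLen r := by
    ext p
    have := h (-p)
    simp only [Bead] at this
    simp only [Set.mem_range]
    constructor
    · rintro ⟨r, hr⟩
      obtain ⟨r', hr'⟩ := this.1 ⟨r, by omega⟩
      exact ⟨r', by omega⟩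
    · rintro ⟨r, hr⟩
      obtain ⟨r', hr'⟩ := this.2 ⟨r, by omega⟩
      exact ⟨r', by omega⟩
  have he := ((hmono γ).range_inj (hmono δ)).1 hr
  ext ⟨r, c⟩
  have hrc : (r : ℤ) - γ.rowLen r = r - δ.rowLen r := congrFun he r
  rw [YoungDiagram.mem_cells, YoungDiagram.mem_cells, YoungDiagram.mem_iff_lt_rowLen,
    YoungDiagram.mem_iff_lt_rowLen]
  omega

/-- The last bead in each residue class. -/
noncomputable def lastBead (k : ℕ) (γ : YoungDiagram) (i : ZMod (k + 1)) : ℤ :=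
  sSup {p : ℤ | (p : ZMod (k + 1)) = i ∧ Bead γ p}

theorem bead_of_le {p : ℤ} (h : p ≤ -(γ.colLen 0)) : Bead γ p := by
  refine ⟨(-p).toNat, ?_⟩
  have := mem_rowLen_iff_colLen γ (-p).toNat 0
  omega

theorem lastBead_spec (k : ℕ) (γ : YoungDiagram) (i : ZMod (k + 1)) :
    IsGreatest {p : ℤ | (p : ZMod (k + 1)) = i ∧ Bead γ p} (lastBead k γ i) := by
  have hb : BddAbove {p : ℤ | (p : ZMod (k + 1)) = i ∧ Bead γ p} := by
    refine ⟨γ.rowLen 0, ?_⟩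
    rintro p ⟨-, r, hr⟩
    have := γ.rowLen_anti 0 r (Nat.zero_le r)
    omega
  have hn : {p : ℤ | (p : ZMod (k + 1)) = i ∧ Bead γ p}.Nonempty := by
    refine ⟨i.val - (k + 1 : ℕ) * (γ.colLen 0 + 1), ?_, bead_of_le ?_⟩
    · push_cast [ZMod.natCast_zmod_val]
      have : ((k : ZMod (k + 1)) + 1) = 0 := by exact_mod_cast ZMod.natCast_self (k + 1)
      rw [this, zero_mul, sub_zero]
    · have := ZMod.val_lt i
      push_cast
      nlinarith
  exact ⟨Int.csSup_mem hn hb, fun p hp => le_csSup hb hp⟩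

theorem cong_lastBead (k : ℕ) (γ : YoungDiagram) : Cong (lastBead k γ) := fun i =>
  (lastBead_spec k γ i).1.1

theorem bead_iff_le (hγ : IsCore (k + 1) γ) (p : ℤ) : Bead γ p ↔ p ≤ lastBead k γ p := by
  constructor
  · exact fun h => (lastBead_spec k γ p).2 ⟨rfl, h⟩
  · intro h
    obtain ⟨h1, h2⟩ := (lastBead_spec k γ p).1
    have hd : ((k + 1 : ℕ) : ℤ) ∣ lastBead k γ p - p := by
      rw [← ZMod.intCast_zmod_eq_zero_iff_dvd _ (k + 1), Int.cast_sub, h1, sub_self]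
    obtain ⟨m, hm⟩ := hd
    have hm0 : 0 ≤ m := by
      by_contra! hneg
      have : ((k + 1 : ℕ) : ℤ) * m < 0 := mul_neg_of_pos_of_neg (by positivity) hneg
      omega
    have hdown : ∀ (j : ℕ) (p' : ℤ), Bead γ p' → Bead γ (p' - (k + 1 : ℕ) * j) := by
      intro j
      induction j with
      | zero => intro p' h; simpa using h
      | succ j ih =>
        intro p' h
        have := (isCore_iff (k + 1)).1 hγ _ (ih p' h)
        convert this using 1
        push_cast
        ring
    have := hdown m.toNat _ h2
    rw [Int.toNat_of_nonneg hm0] at this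
    convert this using 1
    omega

theorem lastBead_eq {q : ZMod (k + 1) → ℤ} (hq : Cong q) (h : ∀ p, Bead γ p ↔ p ≤ q p) :
    lastBead k γ = q := by
  funext i
  refine IsGreatest.csSup_eq ⟨⟨hq i, (h _).2 (by rw [hq i])⟩, ?_⟩
  rintro p ⟨rfl, hp⟩
  exact (h p).1 hp

theorem eq_of_lastBead_eq {γ δ : YoungDiagram} (hγ : IsCore (k + 1) γ) (hδ : IsCore (k + 1) δ)
    (h : lastBead k γ = lastBead k δ) : γ = δ :=
  eq_of_bead_iff fun p => by rw [bead_iff_le hγ, bead_iff_le hδ, h]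

theorem residue_of_content {r c : ℕ} {p : ℤ} (h : (c : ℤ) = r + p) :
    residue k (r, c) = (p : ZMod (k + 1)) := by
  rw [show p = c - r by omega, residue]
  push_cast
  rfl

theorem residue_eq_cast (k : ℕ) (c : ℕ × ℕ) :
    residue k c = (((c.2 : ℤ) - c.1 : ℤ) : ZMod (k + 1)) := by
  rw [residue]
  push_cast
  rfl

theorem removable_lt (hγ : IsCore (k + 1) γ) {c : ℕ × ℕ} (h : Removable γ c) :
    lastBead k γ (residue k c) < c.2 - c.1 ∧
      (c.2 : ℤ) - c.1 < lastBead k γ (residue k c + 1) := by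
  obtain ⟨h1, h2⟩ := bead_of_removable (r := c.1) (c := c.2) h (p := c.2 - c.1) (by ring)
  rw [bead_iff_le hγ, ← residue_eq_cast] at h1
  rw [bead_iff_le hγ, Int.cast_add, ← residue_eq_cast, Int.cast_one] at h2
  omega

theorem addable_le (hγ : IsCore (k + 1) γ) {c : ℕ × ℕ} (h : Addable γ c) :
    (c.2 : ℤ) - c.1 ≤ lastBead k γ (residue k c) ∧
      lastBead k γ (residue k c + 1) ≤ c.2 - c.1 := by
  obtain ⟨h1, h2⟩ := bead_of_addable (r := c.1) (c := c.2) h (p := c.2 - c.1) (by ring)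
  rw [bead_iff_le hγ, ← residue_eq_cast] at h1
  rw [bead_iff_le hγ, Int.cast_add, ← residue_eq_cast, Int.cast_one] at h2
  omega

theorem not_removable_of_addable (hγ : IsCore (k + 1) γ) {c d : ℕ × ℕ} (hc : Addable γ c)
    (hd : Removable γ d) : residue k c ≠ residue k d := by
  intro h
  have h1 := addable_le hγ hc
  have h2 := removable_lt hγ hd
  rw [h] at h1
  omega

/-- A core has a removable corner of residue `i` precisely when the beads of the classes `i` and
`i + 1` allow it; the lowest one has the content stated here. -/
theorem exists_removable_residue (hγ : IsCore (k + 1) γ) {i : ZMod (k + 1)}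
    (h : lastBead k γ i + 1 < lastBead k γ (i + 1)) :
    ∃ c, Removable γ c ∧ residue k c = i ∧ (c.2 : ℤ) - c.1 = lastBead k γ (i + 1) - 1 := by
  have hp : ((lastBead k γ (i + 1) - 1 : ℤ) : ZMod (k + 1)) = i := by
    push_cast
    rw [cong_lastBead, add_sub_cancel_right]
  obtain ⟨r, c, h1, h2⟩ := exists_removable (γ := γ) (p := lastBead k γ (i + 1) - 1)
    (by rw [bead_iff_le hγ, hp]; omega)
    (by rw [bead_iff_le hγ, sub_add_cancel, cong_lastBead])
  exact ⟨(r, c), h1, by rw [residue_of_content h2, hp], by simp only; omega⟩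

end Beads

section AddAll

variable {k : ℕ}

/-- The diagram obtained by adding all addable corners of residue `i`. -/
noncomputable def addAll (i : ZMod (k + 1)) (γ : YoungDiagram) : YoungDiagram where
  cells := γ.cells ∪ {c ∈ (Finset.range (γ.colLen 0 + 1)).image fun r => (r, γ.rowLen r) |
    Addable γ c ∧ residue k c = i}
  isLowerSet := by
    intro c d hdc hc
    simp only [Finset.coe_union, Set.mem_union, Finset.mem_coe, Finset.mem_filter] at hc ⊢
    rcases hc with hc | ⟨h1, h2, h3⟩
    · exact Or.inl (γ.isLowerSet hdc hc)
    · by_cases h : d = c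
      · subst h
        exact Or.inr ⟨h1, h2, h3⟩
      · exact Or.inl ((YoungDiagram.mem_cells d).2 (h2.2 d hdc h))

theorem mem_addAll {i : ZMod (k + 1)} {γ : YoungDiagram} {c : ℕ × ℕ} :
    c ∈ addAll i γ ↔ c ∈ γ ∨ Addable γ c ∧ residue k c = i := by
  rw [← YoungDiagram.mem_cells, addAll, Finset.mem_union, YoungDiagram.mem_cells,
    Finset.mem_filter, Finset.mem_image]
  refine or_congr_right ⟨And.right, fun h => ⟨?_, h⟩⟩
  obtain ⟨r, c⟩ := c
  have h1 := addable_iff.1 h.1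
  refine ⟨r, ?_, by rw [h1.1]⟩
  have := γ.colLen_anti 0 c (Nat.zero_le c)
  rw [Finset.mem_range]
  omega

theorem le_addAll (i : ZMod (k + 1)) (γ : YoungDiagram) : γ ≤ addAll i γ :=
  fun _ h => mem_addAll.2 (Or.inl h)

theorem rowLen_addAll (i : ZMod (k + 1)) (γ : YoungDiagram) (r : ℕ) :
    (addAll i γ).rowLen r =
      if Addable γ (r, γ.rowLen r) ∧ residue k (r, γ.rowLen r) = i then γ.rowLen r + 1
      else γ.rowLen r := by
  have key : ∀ c, c < (addAll i γ).rowLen r ↔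
      c < γ.rowLen r ∨ c = γ.rowLen r ∧
        (Addable γ (r, γ.rowLen r) ∧ residue k (r, γ.rowLen r) = i) := by
    intro c
    rw [← YoungDiagram.mem_iff_lt_rowLen, mem_addAll, YoungDiagram.mem_iff_lt_rowLen]
    refine or_congr_right ⟨fun h => ?_, ?_⟩
    · have := (addable_iff.1 h.1).1
      subst this
      exact ⟨rfl, h⟩
    · rintro ⟨rfl, h⟩
      exact h
  have hle : 0 < γ.rowLen r → γ.rowLen r - 1 < (addAll i γ).rowLen r := fun h =>
    (key _).2 (Or.inl (Nat.sub_lt h one_pos))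
  split_ifs with h
  · have h0 := (key (γ.rowLen r)).2 (Or.inr ⟨rfl, h⟩)
    have h1 : ¬ γ.rowLen r + 1 < (addAll i γ).rowLen r := by
      rw [key]
      rintro (h | ⟨h, -⟩) <;> omega
    omega
  · have h0 : ¬ γ.rowLen r < (addAll i γ).rowLen r := by
      rw [key]
      rintro (h' | ⟨-, h'⟩)
      · omega
      · exact h h'
    omega

theorem bead_addAll (hk : 1 ≤ k) {i : ZMod (k + 1)} {γ : YoungDiagram} (p : ℤ) :
    Bead (addAll i γ) p ↔
      if (p : ZMod (k + 1)) = i then Bead γ p ∧ Bead γ (p + 1)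
      else if (p : ZMod (k + 1)) = i + 1 then Bead γ (p - 1) ∨ Bead γ p else Bead γ p := by
  have hstay : ∀ r : ℕ, ∀ p : ℤ, (γ.rowLen r : ℤ) = r + p → (p : ZMod (k + 1)) ≠ i →
      Bead (addAll i γ) p := by
    intro r p hr hp
    refine ⟨r, ?_⟩
    rw [rowLen_addAll, if_neg, hr]
    rw [residue_of_content hr]
    exact fun h => hp h.2
  have hback : Bead (addAll i γ) p → (Bead γ p ∧ ((p : ZMod (k + 1)) = i → Bead γ (p + 1))) ∨
      (Bead γ (p - 1) ∧ (p : ZMod (k + 1)) = i + 1) := by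
    rintro ⟨r, hr⟩
    rw [rowLen_addAll] at hr
    split_ifs at hr with h
    · right
      have h1 : (γ.rowLen r : ℤ) = r + (p - 1) := by push_cast at hr; omega
      refine ⟨⟨r, h1⟩, ?_⟩
      have h2 := h.2
      rw [residue_of_content h1] at h2
      rw [← h2]
      push_cast
      ring
    · left
      refine ⟨⟨r, hr⟩, fun hp => ?_⟩
      by_contra hb
      obtain ⟨c, hc⟩ := not_bead_iff.1 hb
      refine h ⟨addable_iff.2 ⟨rfl, ?_⟩, by rw [residue_of_content hr, hp]⟩
      have : γ.rowLen r = c := by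
        have := mem_rowLen_iff_colLen γ r c
        omega
      rw [this]
      omega
  split_ifs with h1 h2
  · constructor
    · intro h
      rcases hback h with h | h
      · exact ⟨h.1, h.2 h1⟩
      · exact absurd (h.2.symm.trans h1) (add_one_ne hk i)
    · rintro ⟨⟨r, hr⟩, hb⟩
      refine ⟨r, ?_⟩
      rw [rowLen_addAll, if_neg, hr]
      exact fun h => (bead_of_addable h.1 hr).2 hb
  · constructor
    · intro h
      rcases hback h with h | h
      · exact Or.inr h.1
      · exact Or.inl h.1
    · intro h
      by_cases hb : Bead γ p
      · obtain ⟨r, hr⟩ := hb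
        exact hstay r p hr h1
      · obtain ⟨r, c, hadd, hc⟩ := exists_addable (h.resolve_right hb)
          (by rwa [sub_add_cancel])
        have hr := (addable_iff.1 hadd).1
        refine ⟨r, ?_⟩
        rw [rowLen_addAll, hr, if_pos]
        · push_cast
          omega
        · refine ⟨hadd, ?_⟩
          rw [residue_of_content hc]
          push_cast
          rw [h2, add_sub_cancel_right]
  · constructor
    · intro h
      rcases hback h with h | h
      · exact h.1
      · exact absurd h.2 h2
    · rintro ⟨r, hr⟩
      exact hstay r p hr h1

theorem Cong.move {q : ZMod (k + 1) → ℤ} (hq : Cong q) (i : ZMod (k + 1)) : Cong (move i q) := by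
  intro j
  simp only [AffineKTheory.move]
  split_ifs with h1 h2
  · rcases min_choice (q i) (q (i + 1) - 1) with h | h <;> rw [h]
    · rw [hq i, h1]
    · push_cast
      rw [hq (i + 1), h1, add_sub_cancel_right]
  · rcases max_choice (q i + 1) (q (i + 1)) with h | h <;> rw [h]
    · push_cast
      rw [hq i, h2]
    · rw [hq (i + 1), h2]
  · exact hq j

theorem bead_addAll_iff_le (hk : 1 ≤ k) {γ : YoungDiagram} (hγ : IsCore (k + 1) γ)
    (i : ZMod (k + 1)) (p : ℤ) :
    Bead (addAll i γ) p ↔ p ≤ move i (lastBead k γ) p := by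
  rw [bead_addAll hk, bead_iff_le hγ p, bead_iff_le hγ (p + 1), bead_iff_le hγ (p - 1), move]
  push_cast
  split_ifs with h1 h2
  · rw [h1]
    omega
  · rw [h2, add_sub_cancel_right]
    omega
  · rfl

theorem isCore_addAll (hk : 1 ≤ k) {γ : YoungDiagram} (hγ : IsCore (k + 1) γ)
    (i : ZMod (k + 1)) : IsCore (k + 1) (addAll i γ) := by
  rw [isCore_iff]
  intro p h
  rw [bead_addAll_iff_le hk hγ] at h ⊢
  have : ((p - (k + 1 : ℕ) : ℤ) : ZMod (k + 1)) = p := by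
    rw [Int.cast_sub, Int.cast_natCast, ZMod.natCast_self, sub_zero]
  rw [this]
  omega

theorem lastBead_addAll (hk : 1 ≤ k) {γ : YoungDiagram} (hγ : IsCore (k + 1) γ)
    (i : ZMod (k + 1)) : lastBead k (addAll i γ) = move i (lastBead k γ) :=
  lastBead_eq ((cong_lastBead k γ).move i) (bead_addAll_iff_le hk hγ i)

theorem exists_removable_addAll_iff (hk : 1 ≤ k) {γ : YoungDiagram} (hγ : IsCore (k + 1) γ)
    (i : ZMod (k + 1)) :
    (∃ c, Removable (addAll i γ) c ∧ residue k c = i) ↔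
      lastBead k γ i + 1 ≠ lastBead k γ (i + 1) := by
  have hν := isCore_addAll hk hγ i
  have e1 : lastBead k (addAll i γ) i = min (lastBead k γ i) (lastBead k γ (i + 1) - 1) := by
    rw [lastBead_addAll hk hγ, move, if_pos rfl]
  have e2 : lastBead k (addAll i γ) (i + 1) =
      max (lastBead k γ i + 1) (lastBead k γ (i + 1)) := by
    rw [lastBead_addAll hk hγ, move, if_neg (add_one_ne hk i), if_pos rfl]
  constructor
  · rintro ⟨c, hc, rfl⟩
    have := removable_lt hν hc
    omega
  · intro h
    obtain ⟨c, h1, h2, -⟩ := exists_removable_residue (i := i) hν (by omega)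
    exact ⟨c, h1, h2⟩

theorem removable_of_mem_addAll {γ : YoungDiagram} {i : ZMod (k + 1)} {c : ℕ × ℕ}
    (hc : c ∈ addAll i γ) (hc' : c ∉ γ) : Removable (addAll i γ) c ∧ residue k c = i := by
  refine ⟨⟨hc, fun h1 => hc' ?_, fun h1 => hc' ?_⟩, ((mem_addAll.1 hc).resolve_left hc').2⟩
  · rcases mem_addAll.1 h1 with h1 | h1
    · exact γ.up_left_mem (Nat.le_succ _) le_rfl h1
    · exact h1.1.2 c ⟨Nat.le_succ _, le_rfl⟩ fun h => by simpa using congrArg Prod.fst h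
  · rcases mem_addAll.1 h1 with h1 | h1
    · exact γ.up_left_mem le_rfl (Nat.le_succ _) h1
    · exact h1.1.2 c ⟨le_rfl, Nat.le_succ _⟩ fun h => by simpa using congrArg Prod.snd h

end AddAll

section Growth

variable {k : ℕ}

/-- The shapes obtained from the empty one by successively adding all addable corners of the
residues prescribed by `ι`. -/
noncomputable def shape (ι : ℕ → ZMod (k + 1)) : ℕ → YoungDiagram
  | 0 => ⊥
  | x + 1 => addAll (ι x) (shape ι x)

/-- The filling in which the letter `y + 1` occupies the removable corners of residue `ι y` of
the shape at time `y + 1`. -/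
noncomputable def fill (ι : ℕ → ZMod (k + 1)) (N : ℕ) (c : ℕ × ℕ) : Finset ℕ :=
  (Finset.Icc 1 N).filter fun x => Removable (shape ι x) c ∧ residue k c = ι (x - 1)

/-- Each of the first `N` steps of the growth process produces a removable corner. -/
def Growing (ι : ℕ → ZMod (k + 1)) (N : ℕ) : Prop :=
  ∀ y < N, lastBead k (shape ι y) (ι y) + 1 ≠ lastBead k (shape ι y) (ι y + 1)

variable {ι : ℕ → ZMod (k + 1)}

theorem isCore_bot (p : ℕ) : IsCore p ⊥ :=
  fun c hc => absurd hc (YoungDiagram.notMem_bot c)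

theorem isCore_shape (hk : 1 ≤ k) (x : ℕ) : IsCore (k + 1) (shape ι x) := by
  induction x with
  | zero => exact isCore_bot _
  | succ x ih => exact isCore_addAll hk ih _

theorem shape_mono : Monotone (shape ι) :=
  monotone_nat_of_le_succ fun _ => le_addAll _ _

theorem exists_step {c : ℕ × ℕ} {a b : ℕ} (ha : c ∉ shape ι a) (hb : c ∈ shape ι b) :
    ∃ y, a ≤ y ∧ y < b ∧ c ∉ shape ι y ∧ Removable (shape ι (y + 1)) c ∧ residue k c = ι y := by
  induction b with
  | zero => exact absurd hb (YoungDiagram.notMem_bot c)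
  | succ b ih =>
    by_cases h : c ∈ shape ι b
    · obtain ⟨y, h1, h2, h3⟩ := ih h
      exact ⟨y, h1, by omega, h3⟩
    · refine ⟨b, ?_, by omega, h, removable_of_mem_addAll hb h⟩
      by_contra hab
      exact ha (shape_mono (by omega : b + 1 ≤ a) hb)

theorem succ_mem_fill {N y : ℕ} {c : ℕ × ℕ} :
    y + 1 ∈ fill ι N c ↔ y < N ∧ Removable (shape ι (y + 1)) c ∧ residue k c = ι y := by
  simp only [fill, Finset.mem_filter, Finset.mem_Icc, Nat.add_sub_cancel]
  constructor
  · rintro ⟨⟨-, h⟩, h'⟩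
    exact ⟨h, h'⟩
  · rintro ⟨h, h'⟩
    exact ⟨⟨by omega, h⟩, h'⟩

theorem exists_of_mem_fill {N x : ℕ} {c : ℕ × ℕ} (h : x ∈ fill ι N c) :
    ∃ y < N, x = y + 1 ∧ Removable (shape ι (y + 1)) c ∧ residue k c = ι y := by
  have hx : 1 ≤ x := (Finset.mem_Icc.1 (Finset.mem_filter.1 h).1).1
  obtain ⟨y, rfl⟩ : ∃ y, x = y + 1 := ⟨x - 1, by omega⟩
  have := succ_mem_fill.1 h
  exact ⟨y, this.1, rfl, this.2⟩

theorem mem_shape_iff {N x : ℕ} (hx : x ≤ N) {c : ℕ × ℕ} :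
    c ∈ shape ι x ↔ ∃ y ∈ fill ι N c, y ≤ x := by
  constructor
  · intro h
    obtain ⟨y, -, h2, -, h3⟩ := exists_step (a := 0) (YoungDiagram.notMem_bot c) h
    exact ⟨y + 1, succ_mem_fill.2 ⟨by omega, h3⟩, h2⟩
  · rintro ⟨y, hy, hyx⟩
    obtain ⟨y, -, rfl, h, -⟩ := exists_of_mem_fill hy
    exact shape_mono hyx h.1

theorem isSVFilling_fill (N : ℕ) : IsSVFilling (shape ι N) (fill ι N) := by
  have key : ∀ c d : ℕ × ℕ, ∀ x ∈ fill ι N c, ∀ y ∈ fill ι N d,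
      (d = (c.1 + 1, c.2) ∨ d = (c.1, c.2 + 1)) → x < y := by
    intro c d x hx y hy hcd
    obtain ⟨x, -, rfl, h1, -⟩ := exists_of_mem_fill hx
    obtain ⟨y, -, rfl, h2, -⟩ := exists_of_mem_fill hy
    by_contra h
    have h3 := shape_mono (not_lt.1 h) h2.1
    rcases hcd with rfl | rfl
    · exact h1.2.1 h3
    · exact h1.2.2 h3
  refine ⟨fun c => ?_, fun c x hx => ?_, fun r c x hx y hy => ?_, fun r c x hx y hy => ?_⟩
  · rw [mem_shape_iff le_rfl]
    constructor
    · rintro ⟨y, hy, -⟩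
      exact ⟨y, hy⟩
    · rintro ⟨y, hy⟩
      obtain ⟨z, hz, rfl, -⟩ := exists_of_mem_fill hy
      exact ⟨_, hy, hz⟩
  · obtain ⟨y, -, rfl, -⟩ := exists_of_mem_fill hx
    omega
  · exact key _ _ x hx y hy (Or.inl rfl)
  · exact (key _ _ x hx y hy (Or.inr rfl)).le

theorem shapeLe_fill {N x : ℕ} (hx : x ≤ N) :
    (shape ι x).cells = shapeLe (shape ι N) (fill ι N) x := by
  ext c
  simp only [shapeLe, Finset.mem_filter, YoungDiagram.mem_cells, mem_shape_iff hx,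
    mem_shape_iff le_rfl]
  exact ⟨fun ⟨y, hy, h⟩ => ⟨⟨y, hy, h.trans hx⟩, y, hy, h⟩, fun h => h.2⟩

theorem isStdASVT_fill (hk : 1 ≤ k) {N : ℕ} (hι : Growing ι N) :
    IsStdASVT k N (shape ι N) (fill ι N) := by
  refine ⟨isSVFilling_fill N, fun c y hy => ?_, fun x hx hxN => ?_⟩
  · obtain ⟨z, hz, rfl, -⟩ := exists_of_mem_fill hy
    exact hz
  · obtain ⟨y, rfl⟩ : ∃ y, x = y + 1 := ⟨x - 1, by omega⟩
    refine ⟨shape ι (y + 1), isCore_shape hk _, shapeLe_fill hxN, ι y, ?_, fun c => ?_⟩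
    · obtain ⟨c, hc⟩ := (exists_removable_addAll_iff hk (isCore_shape hk y) (ι y)).2 (hι y hxN)
      exact ⟨c, succ_mem_fill.2 ⟨hxN, hc⟩⟩
    · rw [succ_mem_fill]
      exact and_iff_right hxN

theorem shapeLe_zero {γ : YoungDiagram} {e : ℕ × ℕ → Finset ℕ} (he : IsSVFilling γ e) :
    shapeLe γ e 0 = ∅ := by
  refine Finset.eq_empty_of_forall_notMem fun c hc => ?_
  obtain ⟨y, hy, h⟩ := (Finset.mem_filter.1 hc).2
  have := he.2.1 c y hy
  omega

/-- If the letter `x` occupies exactly the removable `i`-corners of the shape `ν` of `T_{≤x}`,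
then `ν` arises by adding all addable `i`-corners. -/
theorem eq_addAll {γ δ ν : YoungDiagram} {e : ℕ × ℕ → Finset ℕ} {x : ℕ} {i : ZMod (k + 1)}
    (hν : IsCore (k + 1) ν) (h1 : δ.cells = shapeLe γ e x) (h2 : ν.cells = shapeLe γ e (x + 1))
    (h : ∀ c, x + 1 ∈ e c ↔ Removable ν c ∧ residue k c = i) (hne : ∃ c, x + 1 ∈ e c) :
    ν = addAll i δ := by
  have m1 : ∀ c, c ∈ δ ↔ c ∈ γ ∧ ∃ y ∈ e c, y ≤ x := fun c => by
    rw [← YoungDiagram.mem_cells, h1, shapeLe, Finset.mem_filter, YoungDiagram.mem_cells]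
  have m2 : ∀ c, c ∈ ν ↔ c ∈ γ ∧ ∃ y ∈ e c, y ≤ x + 1 := fun c => by
    rw [← YoungDiagram.mem_cells, h2, shapeLe, Finset.mem_filter, YoungDiagram.mem_cells]
  have hle : ∀ c, c ∈ δ → c ∈ ν := fun c hc => by
    obtain ⟨hγ, y, hy, hyx⟩ := (m1 c).1 hc
    exact (m2 c).2 ⟨hγ, y, hy, by omega⟩
  have hdiff : ∀ c, c ∈ ν → c ∉ δ → Removable ν c ∧ residue k c = i := fun c hc hc' => by
    obtain ⟨hγ, y, hy, hyx⟩ := (m2 c).1 hc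
    have : y = x + 1 := by
      by_contra hne
      exact hc' ((m1 c).2 ⟨hγ, y, hy, by omega⟩)
    exact (h c).1 (this ▸ hy)
  obtain ⟨d, hd⟩ := hne
  have hd := (h d).1 hd
  refine YoungDiagram.ext (Finset.ext fun c => ?_)
  rw [YoungDiagram.mem_cells, YoungDiagram.mem_cells, mem_addAll]
  constructor
  · intro hc
    by_cases hc' : c ∈ δ
    · exact Or.inl hc'
    have hr := hdiff c hc hc'
    refine Or.inr ⟨⟨hc', fun a ha hac => ?_⟩, hr.2⟩
    by_contra haδ
    have haν := (hdiff a (ν.up_left_mem ha.1 ha.2 hc) haδ).1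
    rcases lt_or_eq_of_le ha.1 with h1 | h1
    · exact haν.2.1 (ν.up_left_mem h1 ha.2 hc)
    · rcases lt_or_eq_of_le ha.2 with h2 | h2
      · exact haν.2.2 (ν.up_left_mem ha.1 h2 hc)
      · exact hac (Prod.ext h1 h2)
  · rintro (hc | ⟨hc, hi⟩)
    · exact hle c hc
    · by_contra hcν
      exact not_removable_of_addable hν ⟨hcν, fun a ha hac => hle a (hc.2 a ha hac)⟩ hd.1
        (hi.trans hd.2.symm)

theorem exists_growing (hk : 1 ≤ k) {N : ℕ} {γ : YoungDiagram} {e : ℕ × ℕ → Finset ℕ}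
    (he : IsStdASVT k N γ e) :
    ∃ ι : ℕ → ZMod (k + 1), (∀ y, N ≤ y → ι y = 0) ∧ Growing ι N ∧ γ = shape ι N ∧
      e = fill ι N := by
  obtain ⟨hf, hN, hstd⟩ := he
  have hstd' : ∀ y : ℕ, ∃ i : ZMod (k + 1), (N ≤ y → i = 0) ∧ (y < N → ∃ δ : YoungDiagram,
      IsCore (k + 1) δ ∧ δ.cells = shapeLe γ e (y + 1) ∧ (∃ c, y + 1 ∈ e c) ∧
        ∀ c, y + 1 ∈ e c ↔ Removable δ c ∧ residue k c = i) := by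
    intro y
    by_cases hy : y < N
    · obtain ⟨δ, h1, h2, i, h3, h4⟩ := hstd (y + 1) (by omega) hy
      exact ⟨i, fun h => absurd h (not_le.2 hy), fun _ => ⟨δ, h1, h2, h3, h4⟩⟩
    · exact ⟨0, fun _ => rfl, fun h => absurd h hy⟩
  choose ι h0 hι using hstd'
  have hcells : ∀ x ≤ N, (shape ι x).cells = shapeLe γ e x := by
    intro x
    induction x with
    | zero => exact fun _ => (shapeLe_zero hf).symm
    | succ x ih =>
      intro hx
      obtain ⟨δ, h1, h2, h3, h4⟩ := hι x hx
      rw [shape, ← eq_addAll h1 (ih (by omega)) h2 h4 h3, h2]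
  have hocc : ∀ y < N, (∃ c, y + 1 ∈ e c) ∧
      ∀ c, y + 1 ∈ e c ↔ Removable (shape ι (y + 1)) c ∧ residue k c = ι y := by
    intro y hy
    obtain ⟨δ, h1, h2, h3, h4⟩ := hι y hy
    have : δ = shape ι (y + 1) := YoungDiagram.ext (by rw [h2, hcells _ hy])
    exact ⟨h3, this ▸ h4⟩
  refine ⟨ι, h0, fun y hy => ?_, ?_, ?_⟩
  · rw [← exists_removable_addAll_iff hk (isCore_shape hk y)]
    obtain ⟨c, hc⟩ := (hocc y hy).1
    exact ⟨c, ((hocc y hy).2 c).1 hc⟩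
  · refine YoungDiagram.ext (Finset.ext fun c => ?_)
    rw [hcells N le_rfl, shapeLe, Finset.mem_filter, YoungDiagram.mem_cells]
    refine (and_iff_left_of_imp fun hc => ?_).symm
    obtain ⟨y, hy⟩ := (hf.1 c).1 hc
    exact ⟨y, hy, hN c y hy⟩
  · funext c
    ext x
    rcases x with _ | y
    · refine ⟨fun h => absurd (hf.2.1 c 0 h) (lt_irrefl 0), fun h => ?_⟩
      obtain ⟨y, -, h, -⟩ := exists_of_mem_fill h
      omega
    · rw [succ_mem_fill]
      constructor
      · intro h
        have hy := hN c _ h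
        exact ⟨hy, ((hocc y hy).2 c).1 h⟩
      · rintro ⟨hy, h⟩
        exact ((hocc y hy).2 c).2 h

theorem eq_of_fill_eq (hk : 1 ≤ k) {ι' : ℕ → ZMod (k + 1)} {N : ℕ} (hι : Growing ι N)
    (h : fill ι N = fill ι' N) {y : ℕ} (hy : y < N) : ι y = ι' y := by
  obtain ⟨c, hc⟩ := (exists_removable_addAll_iff hk (isCore_shape hk y) (ι y)).2 (hι y hy)
  have h1 : y + 1 ∈ fill ι N c := succ_mem_fill.2 ⟨hy, hc⟩
  rw [h] at h1
  exact hc.2.symm.trans (succ_mem_fill.1 h1).2.2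

end Growth

section Blocks

variable {k : ℕ} {ι : ℕ → ZMod (k + 1)}

/-- The value attached to step `y` of the growth process. -/
noncomputable def stepTop (ι : ℕ → ZMod (k + 1)) (y : ℕ) : ℤ :=
  lastBead k (shape ι (y + 1)) (ι y + 1)

/-- The steps in the interval from `s` to `s'` are compatible with each other. -/
def Compatible (ι : ℕ → ZMod (k + 1)) (s s' : ℕ) : Prop :=
  ∀ y z, s ≤ y → y < z → z < s' → BlockRel (ι y, stepTop ι y) (ι z, stepTop ι z)

theorem Growing.exists_removable (hk : 1 ≤ k) {N y : ℕ} (hι : Growing ι N) (hy : y < N) :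
    ∃ c, Removable (shape ι (y + 1)) c ∧ residue k c = ι y ∧ (c.2 : ℤ) - c.1 = stepTop ι y - 1 := by
  obtain ⟨d, hd, hi⟩ := (exists_removable_addAll_iff hk (isCore_shape hk y) (ι y)).2 (hι y hy)
  have hcore : IsCore (k + 1) (shape ι (y + 1)) := isCore_shape hk _
  have h := removable_lt (γ := shape ι (y + 1)) hcore hd
  rw [hi] at h
  exact exists_removable_residue hcore (by omega)

theorem isLowestOcc_fill (hk : 1 ≤ k) {N y : ℕ} (hι : Growing ι N) (hy : y < N) {c : ℕ × ℕ} :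
    IsLowestOcc (fill ι N) (y + 1) c ↔
      Removable (shape ι (y + 1)) c ∧ residue k c = ι y ∧
        (c.2 : ℤ) - c.1 = stepTop ι y - 1 := by
  have hcore : IsCore (k + 1) (shape ι (y + 1)) := isCore_shape hk _
  have low : ∀ a b, Removable (shape ι (y + 1)) a → Removable (shape ι (y + 1)) b →
      a.1 < b.1 → (b.2 : ℤ) - b.1 < (a.2 : ℤ) - a.1 := by
    intro a b ha hb hab
    have : b.2 < a.2 := by
      by_contra h
      exact ha.2.1 ((shape ι (y + 1)).up_left_mem hab (not_lt.1 h) hb.1)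
    omega
  have top : ∀ a, Removable (shape ι (y + 1)) a → residue k a = ι y →
      (a.2 : ℤ) - a.1 ≤ stepTop ι y - 1 := by
    intro a ha hi
    have := (removable_lt hcore ha).2
    rw [hi] at this
    rw [stepTop]
    omega
  constructor
  · rintro ⟨h1, h2⟩
    have h1 := (succ_mem_fill.1 h1).2
    obtain ⟨d, hd, hi, hc⟩ := hι.exists_removable hk hy
    refine ⟨h1.1, h1.2, ?_⟩
    have hcd := h2 d (succ_mem_fill.2 ⟨hy, hd, hi⟩)
    have ht := top c h1.1 h1.2
    rcases lt_or_eq_of_le hcd with hlt | heq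
    · have := low _ _ h1.1 hd hlt
      omega
    · have : ¬ c.2 < d.2 := fun h => h1.1.2.2 ((shape ι (y + 1)).up_left_mem heq.le h hd.1)
      omega
  · rintro ⟨h1, h2, h3⟩
    refine ⟨succ_mem_fill.2 ⟨hy, h1, h2⟩, fun d hd => ?_⟩
    have hd := (succ_mem_fill.1 hd).2
    by_contra h
    have := low _ _ hd.1 h1 (not_le.1 h)
    have := top d hd.1 hd.2
    omega

theorem image_residue_fill (hk : 1 ≤ k) {N s s' : ℕ} (hs' : s' ≤ N) (hι : Growing ι N) :
    ((shape ι N).cells.filter fun c => ∃ y ∈ Finset.Ioc s s', y ∈ fill ι N c).image (residue k) =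
      (Finset.Ico s s').image ι := by
  ext i
  simp only [Finset.mem_image, Finset.mem_filter, YoungDiagram.mem_cells, Finset.mem_Ioc,
    Finset.mem_Ico]
  constructor
  · rintro ⟨c, ⟨-, x, hx, hxc⟩, rfl⟩
    obtain ⟨y, -, rfl, -, h⟩ := exists_of_mem_fill hxc
    exact ⟨y, by omega, h.symm⟩
  · rintro ⟨y, hy, rfl⟩
    obtain ⟨c, h1, h2, -⟩ := hι.exists_removable hk (by omega : y < N)
    exact ⟨c, ⟨shape_mono (by omega : y + 1 ≤ N) h1.1, y + 1, by omega,
      succ_mem_fill.2 ⟨by omega, h1, h2⟩⟩, h2⟩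

theorem residue_up (c : ℕ × ℕ) : residue k (c.1 + 1, c.2) + 1 = residue k c := by
  simp only [residue]
  push_cast
  ring

theorem residue_diag (c : ℕ × ℕ) : residue k (c.1 + 1, c.2 + 1) = residue k c := by
  simp only [residue]
  push_cast
  ring

theorem Compatible.not_mem {s s' y z : ℕ} (h : Compatible ι s s') (hy : s ≤ y) (hz : z < s')
    {c : ℕ × ℕ} (hc : Removable (shape ι (y + 1)) c) (hi : residue k c = ι y) :
    (c.1 + 1, c.2) ∉ shape ι (z + 1) := by
  intro hm
  obtain ⟨u, h1, h2, -, -, h3⟩ := exists_step hc.2.1 hm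
  refine (h y u hy (by omega) (by omega)).2.1 ?_
  rw [← hi, ← h3, residue_up]

theorem lastBead_shape_of_not_mem (hk : 1 ≤ k) {i : ZMod (k + 1)} {a b : ℕ} (hab : a ≤ b)
    (h : ∀ u, a ≤ u → u < b → ι u ≠ i ∧ ι u + 1 ≠ i) :
    lastBead k (shape ι b) i = lastBead k (shape ι a) i := by
  induction b, hab using Nat.le_induction with
  | base => rfl
  | succ b hab ih =>
    rw [← ih fun u h1 h2 => h u h1 (by omega), shape, lastBead_addAll hk (isCore_shape hk b), move,
      if_neg (h b hab (by omega)).1.symm, if_neg (h b hab (by omega)).2.symm]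

theorem compatible_of_isASVT (hk : 1 ≤ k) {N s s' : ℕ} (hs' : s' ≤ N) (hι : Growing ι N)
    (hread : ∀ y z : ℕ, y ∈ Finset.Ioc s s' → z ∈ Finset.Ioc s s' → y < z →
      ∀ cy cz : ℕ × ℕ, IsLowestOcc (fill ι N) y cy → IsLowestOcc (fill ι N) z cz →
        ReadBefore cy cz)
    (hinj : ∀ y z, s ≤ y → y < z → z < s' → ι y ≠ ι z)
    (hstrip : ∀ c d : ℕ × ℕ, (∃ y ∈ Finset.Ioc s s', y ∈ fill ι N c) →
      (∃ y ∈ Finset.Ioc s s', y ∈ fill ι N d) → c.2 = d.2 → c = d) :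
    Compatible ι s s' := by
  intro y z hy hyz hz
  obtain ⟨cy, hy1, hy2, hy3⟩ := hι.exists_removable hk (by omega : y < N)
  obtain ⟨cz, hz1, hz2, hz3⟩ := hι.exists_removable hk (by omega : z < N)
  have hlt : stepTop ι y < stepTop ι z := by
    have := hread (y + 1) (z + 1) (Finset.mem_Ioc.2 (by omega)) (Finset.mem_Ioc.2 (by omega))
      (by omega) cy cz ((isLowestOcc_fill hk hι (by omega)).2 ⟨hy1, hy2, hy3⟩)
      ((isLowestOcc_fill hk hι (by omega)).2 ⟨hz1, hz2, hz3⟩)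
    rcases this with h | h
    · have : cy.2 < cz.2 := by
        by_contra h'
        exact hz1.2.1 ((shape ι (z + 1)).up_left_mem h (not_lt.1 h')
          (shape_mono (by omega : y + 1 ≤ z + 1) hy1.1))
      omega
    · omega
  refine ⟨hinj y z hy hyz hz, fun hyz' => ?_, hlt⟩
  simp only at hyz'
  have hcz : IsCore (k + 1) (shape ι z) := isCore_shape hk z
  have hstay : lastBead k (shape ι z) (ι y) = lastBead k (shape ι (y + 1)) (ι y) := by
    refine lastBead_shape_of_not_mem hk hyz fun u h1 h2 => ⟨(hinj y u hy h1 (by omega)).symm, ?_⟩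
    rw [hyz']
    exact fun h => hinj u z (by omega) h2 hz (add_right_cancel h)
  have hlow := (removable_lt (isCore_shape hk (y + 1)) hy1).1
  rw [hy2, ← hstay] at hlow
  have htop : stepTop ι z = max (lastBead k (shape ι z) (ι z) + 1)
      (lastBead k (shape ι z) (ι z + 1)) := by
    rw [stepTop, shape, lastBead_addAll hk hcz, move, if_neg (add_one_ne hk _), if_pos rfl]
  rw [← hyz'] at htop
  have hres : (((cy.2 : ℤ) - cy.1 : ℤ) : ZMod (k + 1)) = ι y := by
    rw [← residue_eq_cast, hy2]
  have hb1 : ¬ Bead (shape ι z) (((cy.2 : ℤ) - cy.1 - 1) + 1) := by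
    rw [sub_add_cancel, bead_iff_le hcz, hres]
    omega
  have hb2 : Bead (shape ι z) ((cy.2 : ℤ) - cy.1 - 1) := by
    rw [bead_iff_le hcz, Int.cast_sub, hres, hyz', Int.cast_one, add_sub_cancel_right]
    omega
  obtain ⟨r, c, hadd, hrc⟩ := exists_addable hb2 hb1
  have hmem : cy ∈ shape ι z := shape_mono (by omega : y + 1 ≤ z) hy1.1
  rcases lt_trichotomy r (cy.1 + 1) with h | h | h
  · exact hadd.1 ((shape ι z).up_left_mem (by omega) (by omega) hmem)
  · obtain rfl : c = cy.2 := by omega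
    subst h
    have hz' : residue k (cy.1 + 1, cy.2) = ι z :=
      add_right_cancel ((residue_up cy).trans (hy2.trans hyz'))
    have hin : (cy.1 + 1, cy.2) ∈ addAll (ι z) (shape ι z) := mem_addAll.2 (Or.inr ⟨hadd, hz'⟩)
    have := hstrip cy (cy.1 + 1, cy.2)
      ⟨y + 1, Finset.mem_Ioc.2 (by omega), succ_mem_fill.2 ⟨by omega, hy1, hy2⟩⟩
      ⟨z + 1, Finset.mem_Ioc.2 (by omega), succ_mem_fill.2
        ⟨by omega, removable_of_mem_addAll hin hadd.1⟩⟩ rfl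
    have := congrArg Prod.fst this
    simp only at this
    omega
  · have hin : (cy.1 + 1, cy.2 + 1) ∈ shape ι z := by
      refine hadd.2 _ ⟨by simp only; omega, by simp only; omega⟩ fun h' => ?_
      have := congrArg Prod.fst h'
      simp only at this
      omega
    have hout : (cy.1 + 1, cy.2 + 1) ∉ shape ι (y + 1) := fun h' =>
      hy1.2.1 ((shape ι (y + 1)).up_left_mem le_rfl (Nat.le_succ _) h')
    obtain ⟨u, h1, h2, -, -, h3⟩ := exists_step hout hin
    rw [residue_diag, hy2] at h3
    exact hinj y u hy (by omega) (by omega) h3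

theorem block_fill_iff (hk : 1 ≤ k) {N s s' : ℕ} (hs' : s' ≤ N) (hι : Growing ι N) :
    ((∀ y z : ℕ, y ∈ Finset.Ioc s s' → z ∈ Finset.Ioc s s' → y < z →
      ∀ cy cz : ℕ × ℕ, IsLowestOcc (fill ι N) y cy → IsLowestOcc (fill ι N) z cz →
        ReadBefore cy cz) ∧
    ((((shape ι N).cells.filter fun c => ∃ y ∈ Finset.Ioc s s', y ∈ fill ι N c).image
      (residue k)).card = s' - s) ∧
    (∀ c d : ℕ × ℕ, (∃ y ∈ Finset.Ioc s s', y ∈ fill ι N c) →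
      (∃ y ∈ Finset.Ioc s s', y ∈ fill ι N d) → c.2 = d.2 → c = d)) ↔ Compatible ι s s' := by
  rw [image_residue_fill hk hs' hι, ← Nat.card_Ico, Finset.card_image_iff]
  constructor
  · rintro ⟨h1, h2, h3⟩
    refine compatible_of_isASVT hk hs' hι h1 (fun y z hy hyz hz h => ?_) h3
    have := h2 (by simp; omega) (by simp; omega) h
    omega
  · intro h
    refine ⟨fun y z hy hz hyz cy cz hcy hcz => ?_, fun y hy z hz hyz => ?_, ?_⟩
    · rw [Finset.mem_Ioc] at hy hz
      obtain ⟨y, rfl⟩ : ∃ y', y = y' + 1 := ⟨y - 1, by omega⟩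
      obtain ⟨z, rfl⟩ : ∃ z', z = z' + 1 := ⟨z - 1, by omega⟩
      have hcy := (isLowestOcc_fill hk hι (by omega)).1 hcy
      have hcz := (isLowestOcc_fill hk hι (by omega)).1 hcz
      have hlt := (h y z (by omega) (by omega) (by omega)).2.2
      have hnot := h.not_mem (by omega) (by omega : z < s') hcy.1 hcy.2.1
      simp only at hlt
      rcases lt_trichotomy cz.1 cy.1 with hr | hr | hr
      · exact Or.inl hr
      · exact Or.inr ⟨hr.symm, by omega⟩
      · exact absurd ((shape ι (z + 1)).up_left_mem (Nat.succ_le_of_lt hr) (by omega) hcz.1.1) hnot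
    · rw [Finset.mem_coe, Finset.mem_Ico] at hy hz
      by_contra hne
      rcases lt_or_gt_of_ne hne with hlt | hlt
      · exact (h y z hy.1 hlt hz.2).1 hyz
      · exact (h z y hz.1 hlt hy.2).1 hyz.symm
    · have key : ∀ c d : ℕ × ℕ, (∃ y ∈ Finset.Ioc s s', y ∈ fill ι N c) →
          (∃ y ∈ Finset.Ioc s s', y ∈ fill ι N d) → c.2 = d.2 → ¬ c.1 < d.1 := by
        rintro c d ⟨y, hy, hyc⟩ ⟨z, hz, hzd⟩ hcol hrow
        obtain ⟨y, -, rfl, hy1, hy2⟩ := exists_of_mem_fill hyc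
        obtain ⟨z, -, rfl, hz1, -⟩ := exists_of_mem_fill hzd
        rw [Finset.mem_Ioc] at hy hz
        exact h.not_mem (by omega) (by omega : z < s') hy1 hy2
          ((shape ι (z + 1)).up_left_mem (Nat.succ_le_of_lt hrow) hcol.le hz1.1)
      intro c d hc hd hcol
      have h1 := key c d hc hd hcol
      have h2 := key d c hd hc hcol.symm
      exact Prod.ext (by omega) hcol

end Blocks

section Tableaux

variable {k : ℕ} {ι : ℕ → ZMod (k + 1)}

/-- The word of the values of `ι` at `s, …, s + n - 1`. -/
def word (ι : ℕ → ZMod (k + 1)) (s n : ℕ) : List (ZMod (k + 1)) :=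
  (List.range' s n).map ι

theorem word_succ (s n : ℕ) : word ι s (n + 1) = ι s :: word ι (s + 1) n := by
  rw [word, List.range'_succ, List.map_cons, word]

theorem length_word (s n : ℕ) : (word ι s n).length = n := by
  rw [word, List.length_map, List.length_range']

theorem word_getD (w : List (ZMod (k + 1))) : word (fun y => w.getD y 0) 0 w.length = w := by
  refine List.ext_getElem (length_word _ _) fun y h1 h2 => ?_
  simp [word, h2]

theorem take_word {s n a : ℕ} (ha : a ≤ n) : (word ι s n).take a = word ι s a := by
  rw [word, ← List.map_take, List.take_range'_of_length_ge ha, word]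

theorem drop_word {s n a : ℕ} : (word ι s n).drop a = word ι (s + a) (n - a) := by
  rw [word, ← List.map_drop, List.drop_range', mul_one, word]

theorem run_word (hk : 1 ≤ k) (n : ℕ) : ∀ s, run (lastBead k (shape ι s)) (word ι s n) =
    lastBead k (shape ι (s + n)) := by
  induction n with
  | zero => exact fun s => rfl
  | succ n ih =>
    intro s
    rw [word_succ, run, List.foldl_cons, ← lastBead_addAll hk (isCore_shape hk s), ← shape, ← run,
      ih, Nat.succ_add_eq_add_succ]

theorem valid_word (hk : 1 ≤ k) (n : ℕ) : ∀ s, Valid (lastBead k (shape ι s)) (word ι s n) ↔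
    ∀ y, s ≤ y → y < s + n → lastBead k (shape ι y) (ι y) + 1 ≠ lastBead k (shape ι y) (ι y + 1) := by
  induction n with
  | zero => exact fun s => ⟨fun _ y _ _ => by omega, fun _ => trivial⟩
  | succ n ih =>
    intro s
    rw [word_succ, Valid, ← lastBead_addAll hk (isCore_shape hk s), ← shape, ih]
    constructor
    · rintro ⟨h1, h2⟩ y hy hyn
      rcases eq_or_lt_of_le hy with rfl | hy
      · exact h1
      · exact h2 y hy (by omega)
    · exact fun h => ⟨h s le_rfl (by omega), fun y hy hyn => h y (by omega) (by omega)⟩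

theorem trace_word (hk : 1 ≤ k) (n : ℕ) : ∀ s, trace (lastBead k (shape ι s)) (word ι s n) =
    (List.range' s n).map fun y => (ι y, stepTop ι y) := by
  induction n with
  | zero => exact fun s => rfl
  | succ n ih =>
    intro s
    rw [word_succ, trace, ← lastBead_addAll hk (isCore_shape hk s), ← shape, ih,
      List.range'_succ, List.map_cons, stepTop]

theorem pairwise_trace_word (hk : 1 ≤ k) (s n : ℕ) :
    (trace (lastBead k (shape ι s)) (word ι s n)).Pairwise BlockRel ↔
      Compatible ι s (s + n) := by
  rw [trace_word hk, List.pairwise_map, List.pairwise_iff_getElem]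
  simp only [List.length_range', List.getElem_range', one_mul]
  constructor
  · intro h y z hy hyz hz
    have := h (y - s) (z - s) (by omega) (by omega) (by omega)
    rwa [Nat.add_sub_cancel' hy, Nat.add_sub_cancel' (by omega)] at this
  · exact fun h i j _ _ hij => h (s + i) (s + j) (by omega) (by omega) (by omega)

theorem goodWord_word (hk : 1 ≤ k) (α : List ℕ) : ∀ s n,
    GoodWord α (lastBead k (shape ι s)) (word ι s n) ↔ n = α.sum ∧
      (∀ y, s ≤ y → y < s + n →
        lastBead k (shape ι y) (ι y) + 1 ≠ lastBead k (shape ι y) (ι y + 1)) ∧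
      ∀ x < α.length, Compatible ι (s + (α.take x).sum) (s + (α.take (x + 1)).sum) := by
  induction α with
  | nil =>
    intro s n
    rw [GoodWord, ← List.length_eq_zero_iff, length_word]
    exact ⟨fun h => ⟨h, fun y _ _ => by omega, fun x hx => absurd hx (Nat.not_lt_zero x)⟩,
      fun h => h.1⟩
  | cons a α ih =>
    intro s n
    rw [GoodWord, length_word]
    have hsplit : (∀ x < (a :: α).length,
        Compatible ι (s + ((a :: α).take x).sum) (s + ((a :: α).take (x + 1)).sum)) ↔
        Compatible ι s (s + a) ∧ ∀ x < α.length,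
          Compatible ι (s + a + (α.take x).sum) (s + a + (α.take (x + 1)).sum) := by
      rw [List.length_cons, Nat.forall_lt_succ_left]
      simp [add_assoc]
    rw [hsplit, List.sum_cons]
    by_cases han : a ≤ n
    · rw [take_word han, drop_word, run_word hk, valid_word hk, pairwise_trace_word hk, ih]
      constructor
      · rintro ⟨-, h1, h2, h3, h4, h5⟩
        refine ⟨by omega, fun y hy hyn => ?_, h2, h5⟩
        by_cases hya : y < s + a
        · exact h1 y hy hya
        · exact h4 y (by omega) (by omega)
      · rintro ⟨h1, h2, h3, h4⟩
        exact ⟨han, fun y hy hya => h2 y hy (by omega), h3, by omega,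
          fun y hy hya => h2 y (by omega) (by omega), h4⟩
    · exact ⟨fun h => absurd h.1 han, fun h => by omega⟩

theorem isASVT_fill_iff (hk : 1 ≤ k) {α : List ℕ} (hι : Growing ι α.sum) :
    IsASVT k α (shape ι α.sum) (fill ι α.sum) ↔
      ∀ x < α.length, Compatible ι (α.take x).sum (α.take (x + 1)).sum := by
  rw [IsASVT, and_iff_right (isStdASVT_fill hk hι)]
  have key : ∀ x (hx : x < α.length), α.getD x 0 = (α.take (x + 1)).sum - (α.take x).sum ∧
      (α.take (x + 1)).sum ≤ α.sum := by
    intro x hx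
    refine ⟨?_, ?_⟩
    · rw [List.sum_take_succ _ _ hx, Nat.add_sub_cancel_left, List.getD_eq_getElem _ _ hx]
    · exact (List.take_sublist _ _).sum_le_sum fun _ _ => Nat.zero_le _
  constructor
  · intro h x hx
    have := h (x + 1) (by omega) hx
    rw [Nat.add_sub_cancel, (key x hx).1] at this
    exact (block_fill_iff hk (key x hx).2 hι).1 this
  · intro h x hx hxα
    obtain ⟨x, rfl⟩ : ∃ x', x = x' + 1 := ⟨x - 1, by omega⟩
    rw [Nat.add_sub_cancel, (key x hxα).1]
    exact (block_fill_iff hk (key x hxα).2 hι).2 (h x hxα)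

theorem mem_goodWords_iff (hk : 1 ≤ k) {α : List ℕ} (hα : ∀ a ∈ α, a ≤ k) {γ : YoungDiagram}
    (hγ : IsCore (k + 1) γ) (w : List (ZMod (k + 1))) :
    w ∈ goodWords α (lastBead k ⊥) (lastBead k γ) ↔ w.length = α.sum ∧
      Growing (fun y => w.getD y 0) α.sum ∧ γ = shape (fun y => w.getD y 0) α.sum ∧
        IsASVT k α γ (fill (fun y => w.getD y 0) α.sum) := by
  set ι : ℕ → ZMod (k + 1) := fun y => w.getD y 0 with hdef
  have h1 := goodWord_word (ι := ι) hk α 0 w.length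
  have h2 := run_word (ι := ι) hk w.length 0
  rw [hdef, word_getD, ← hdef] at h1 h2
  simp only [zero_add] at h1 h2
  rw [mem_goodWords hk _ hα _ w (cong_lastBead k ⊥)]
  change GoodWord α (lastBead k (shape ι 0)) w ∧ run (lastBead k (shape ι 0)) w = _ ↔ _
  rw [h1, h2, and_assoc]
  refine and_congr_right fun hlen => ?_
  rw [hlen]
  constructor
  · rintro ⟨⟨h3, h4⟩, h5⟩
    have hg : Growing ι α.sum := fun y hy => h3 y (Nat.zero_le y) hy
    have := eq_of_lastBead_eq (isCore_shape hk _) hγ h5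
    exact ⟨hg, this.symm, this ▸ (isASVT_fill_iff hk hg).2 h4⟩
  · rintro ⟨hg, rfl, h⟩
    exact ⟨⟨fun y _ hy => hg y hy, (isASVT_fill_iff hk hg).1 h⟩, rfl⟩

theorem card_isASVT (hk : 1 ≤ k) {α : List ℕ} (hα : ∀ a ∈ α, a ≤ k) {γ : YoungDiagram}
    (hγ : IsCore (k + 1) γ) :
    Nat.card {e : ℕ × ℕ → Finset ℕ // IsASVT k α γ e} =
      moveCount α (lastBead k ⊥) (lastBead k γ) := by
  rw [← card_goodWords α _ _ (cong_lastBead k ⊥), ← Nat.card_eq_finsetCard]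
  refine (Nat.card_congr (Equiv.ofBijective (fun w => ⟨fill (fun y => w.1.getD y 0) α.sum,
    ((mem_goodWords_iff hk hα hγ w.1).1 w.2).2.2.2⟩) ⟨?_, ?_⟩)).symm
  · rintro ⟨v, hv⟩ ⟨w, hw⟩ h
    have hfill := congrArg Subtype.val h
    simp only at hfill
    have hv := (mem_goodWords_iff hk hα hγ v).1 hv
    have hw := (mem_goodWords_iff hk hα hγ w).1 hw
    refine Subtype.ext (List.ext_getElem (hv.1.trans hw.1.symm) fun y h1 h2 => ?_)
    have := eq_of_fill_eq hk hv.2.1 hfill (y := y) (hv.1 ▸ h1)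
    simpa [h1, h2] using this
  · rintro ⟨e, he⟩
    obtain ⟨ι, h0, hι, hsh, hfill⟩ := exists_growing hk he.1
    have hw : (fun y => (word ι 0 α.sum).getD y 0) = ι := by
      funext y
      by_cases hy : y < α.sum
      · simp [word, hy]
      · rw [List.getD_eq_default _ _ (by rw [length_word]; omega), h0 y (by omega)]
    refine ⟨⟨word ι 0 α.sum, (mem_goodWords_iff hk hα hγ _).2 ⟨length_word _ _, ?_⟩⟩, ?_⟩
    · rw [hw]
      exact ⟨hι, hsh, hfill ▸ he⟩
    · exact Subtype.ext (by simp only [hw, hfill])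

theorem isCore_of_isASVT (hk : 1 ≤ k) {α : List ℕ} {γ : YoungDiagram}
    {e : ℕ × ℕ → Finset ℕ} (he : IsASVT k α γ e) : IsCore (k + 1) γ := by
  obtain ⟨ι, -, -, rfl, -⟩ := exists_growing hk he.1
  exact isCore_shape hk _

end Tableaux

/-- For any `k`-bounded partition `λ` and any two `k`-bounded compositions
`α` and `β` with `β` a rearrangement of `α`, the numbers of affine set-valued tableaux
coincide: `𝒦^{(k)}_{λα} = 𝒦^{(k)}_{λβ}`. -/
theorem Kcal_perm_invariant
    (k : ℕ) (hk : 1 ≤ k) (lam : YoungDiagram) (hlam : IsKBounded k lam)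
    (α β : List ℕ) (hα : IsKBoundedComp k α) (hβ : IsKBoundedComp k β)
    (hperm : α.Perm β) :
    Kcal k lam α = Kcal k lam β := by
  rw [Kcal, Kcal]
  by_cases hγ : IsCore (k + 1) (coreOf k lam)
  · rw [card_isASVT hk (fun a ha => (hα a ha).2) hγ, card_isASVT hk (fun a ha => (hβ a ha).2) hγ,
      moveCount_perm hperm]
  · have hempty : ∀ δ, IsEmpty {e : ℕ × ℕ → Finset ℕ // IsASVT k δ (coreOf k lam) e} :=
      fun δ => ⟨fun e => hγ (isCore_of_isASVT hk e.2)⟩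
    rw [@Nat.card_of_isEmpty _ (hempty α), @Nat.card_of_isEmpty _ (hempty β)]

end AffineKTheory
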